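/- Let K be a field and, for m > l ≥ 1, let I_{m,l} ⊆ K[x₁,…,x_m] be the ideal generated by the (l+1)-minors of the (l+1)×m Vandermonde matrix. For integers n − 1 > k ≥ 2, all j, and all i ≥ 2, the graded Betti numbers satisfy β_{i,j}(R/I_{n,k}) = β_{i,j−k}(R'/I_{n−1,k−1}) + β_{i,j}(R'/I_{n−1,k}) + β_{i−1,j−k}(R'/I_{n−1,k}), where R = K[x₁,…,xₙ] and R' = K[x₁,…,x_{n−1}]. -/

import Mathlib

open MvPolynomial

/-- The `(k+1) × n` Vandermonde matrix of variables: the `(i,j)` entry is `xⱼ^i`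
(rows indexed by `0,…,k`, columns by the variables `x₁,…,xₙ`). -/
noncomputable def vandermondeMatrix (K : Type*) [Field K] (n k : ℕ) :
    Matrix (Fin (k + 1)) (Fin n) (MvPolynomial (Fin n) K) :=
  Matrix.of fun i j => (X j : MvPolynomial (Fin n) K) ^ (i : ℕ)

/-- The ideal generated by all maximal (i.e. `(k+1)`-size) minors of the
Vandermonde matrix `vandermondeMatrix K n k`. -/
noncomputable def vanIdeal (K : Type*) [Field K] (n k : ℕ) :
    Ideal (MvPolynomial (Fin n) K) :=
  Ideal.span { d | ∃ g : Fin (k + 1) ↪ Fin n,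
    d = ((vandermondeMatrix K n k).submatrix id g).det }

/-- Index type for the free module in homological degree `i` of a graded free resolution
with graded Betti numbers `β`: one basis element of internal degree `j` for each
`t < β i j`. -/
def bettiBasis (β : ℕ → ℕ → ℕ) (i : ℕ) : Type := {p : ℕ × ℕ // p.2 < β i p.1}

/-- `β` is the table of graded Betti numbers of a minimal graded free resolution of
`R ⧸ I` over `R = K[x₁,…,xₙ]`, i.e. `β i j = β_{i,j}(R ⧸ I) = dim_K Tor_i(R ⧸ I, K)_j`. -/
def IsMinimalFreeResolution (K : Type*) [Field K] {n : ℕ}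
    (I : Ideal (MvPolynomial (Fin n) K)) (β : ℕ → ℕ → ℕ) : Prop :=
  ∃ (d : ∀ i : ℕ, (bettiBasis β (i + 1) →₀ MvPolynomial (Fin n) K)
        →ₗ[MvPolynomial (Fin n) K] (bettiBasis β i →₀ MvPolynomial (Fin n) K))
    (ε : (bettiBasis β 0 →₀ MvPolynomial (Fin n) K)
        →ₗ[MvPolynomial (Fin n) K] (MvPolynomial (Fin n) K ⧸ I)),
    -- exactness: a free resolution of `R ⧸ I`
    Function.Surjective ε ∧
    LinearMap.ker ε = LinearMap.range (d 0) ∧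
    (∀ i, LinearMap.ker (d i) = LinearMap.range (d (i + 1))) ∧
    -- the differentials are graded: the matrix entry from a generator of internal degree
    -- `j` to a generator of internal degree `j'` is homogeneous of degree `j - j'`
    (∀ i, ∀ b : bettiBasis β (i + 1), ∀ b' : bettiBasis β i,
      (d i (Finsupp.single b 1)) b' = 0 ∨
      (b'.1.1 ≤ b.1.1 ∧ ((d i (Finsupp.single b 1)) b').IsHomogeneous (b.1.1 - b'.1.1))) ∧
    -- minimality: all entries of the differentials lie in the irrelevant maximal ideal
    (∀ i, ∀ b : bettiBasis β (i + 1), ∀ b' : bettiBasis β i,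
      constantCoeff ((d i (Finsupp.single b 1)) b') = 0) ∧
    -- the augmentation is graded: a generator of internal degree `j` maps into the
    -- degree `j` component of `R ⧸ I`
    (∀ b : bettiBasis β 0, ε (Finsupp.single b 1) ∈
      (MvPolynomial.homogeneousSubmodule (Fin n) K b.1.1).map
        (Ideal.Quotient.mkₐ K I).toLinearMap)

/-! ### Complexes built from anticommuting contractions -/

/-- Exponent vectors of monomials in `k` divided power variables, one for each row. -/
inductive RowExp : ℕ → Type
  | nil : RowExp 0
  | snoc {k : ℕ} (a : RowExp k) (b : ℕ) : RowExp (k + 1)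

namespace RowExp

/-- The zero exponent vector. -/
def zero : ∀ k, RowExp k
  | 0 => nil
  | k + 1 => snoc (zero k) 0

/-- The total degree of an exponent vector. -/
def size : ∀ {k}, RowExp k → ℕ
  | _, nil => 0
  | _, snoc a b => size a + b

/-- The weighted degree of an exponent vector, the `r`-th variable having weight `r`. -/
def weight : ∀ {k}, RowExp k → ℕ
  | _, nil => 0
  | k + 1, snoc a b => weight a + (k + 1) * b

theorem size_snoc {k} (a : RowExp k) (b : ℕ) : (snoc a b).size = a.size + b := rfl

theorem size_zero : ∀ k, size (zero k) = 0
  | 0 => rfl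
  | k + 1 => by simp [zero, size, size_zero k]

theorem weight_zero : ∀ k, weight (zero k) = 0
  | 0 => rfl
  | k + 1 => by simp [zero, weight, weight_zero k]

theorem eq_zero_of_size_eq_zero : ∀ {k} (a : RowExp k), size a = 0 → a = zero k
  | _, nil, _ => rfl
  | _, snoc a b, h => by
    have h' : size a + b = 0 := h
    obtain rfl : b = 0 := by omega
    rw [eq_zero_of_size_eq_zero a (by omega)]
    rfl

theorem finite_size_le : ∀ k p, {a : RowExp k | size a ≤ p}.Finite
  | 0, _ => (Set.finite_singleton nil).subset fun
    | nil, _ => rfl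
  | k + 1, p => by
    refine (((finite_size_le k p).prod (Set.finite_le_nat p)).image
      fun x => snoc x.1 x.2).subset ?_
    rintro (_ | ⟨a, b⟩) h
    have h' : size a + b ≤ p := h
    exact ⟨(a, b), ⟨show size a ≤ p by omega, show b ≤ p by omega⟩, rfl⟩

end RowExp

section RowDiff

variable {S L L' : Type*} [CommRing S] [AddCommGroup L] [Module S L] [AddCommGroup L'] [Module S L']

/-- The differential `f ↦ ∑ r, ∂ r (ε_r⁻¹ f)` on `L`-valued functions of exponent vectors. -/
def rowDiff (D : ℕ → L →ₗ[S] L) : ∀ k, (RowExp k → L) →ₗ[S] (RowExp k → L)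
  | 0 => 0
  | k + 1 => LinearMap.pi fun
    | .snoc a b => LinearMap.proj a ∘ₗ rowDiff D k ∘ₗ LinearMap.funLeft S L (fun a => .snoc a b)
        + D (k + 1) ∘ₗ LinearMap.proj (.snoc a (b + 1))

/-- The composite `∂ 1 ∘ ⋯ ∘ ∂ k`. -/
def detMap (D : ℕ → L →ₗ[S] L) : ℕ → L →ₗ[S] L
  | 0 => LinearMap.id
  | k + 1 => detMap D k ∘ₗ D (k + 1)

variable (D : ℕ → L →ₗ[S] L) (D' : ℕ → L' →ₗ[S] L')

theorem rowDiff_zero (f : RowExp 0 → L) : rowDiff D 0 f = 0 := rfl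

theorem rowDiff_succ (k : ℕ) (f : RowExp (k + 1) → L) (a : RowExp k) (b : ℕ) :
    rowDiff D (k + 1) f (.snoc a b) =
      rowDiff D k (fun a' => f (.snoc a' b)) a + D (k + 1) (f (.snoc a (b + 1))) := rfl

theorem detMap_succ (k : ℕ) (u : L) : detMap D (k + 1) u = detMap D k (D (k + 1) u) := rfl

theorem map_rowDiff (T : L →+ L') (h : ∀ r u, T (D r u) = D' r (T u)) (k : ℕ) (f : RowExp k → L)
    (a : RowExp k) : T (rowDiff D k f a) = rowDiff D' k (fun a => T (f a)) a := by
  induction k with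
  | zero => simp [rowDiff_zero]
  | succ k ih =>
    obtain _ | ⟨a, b⟩ := a
    rw [rowDiff_succ, rowDiff_succ, map_add, h, ih]

theorem map_rowDiff_neg (T : L →+ L') (h : ∀ r u, T (D r u) = -D' r (T u)) (k : ℕ)
    (f : RowExp k → L) (a : RowExp k) :
    T (rowDiff D k f a) = -rowDiff D' k (fun a => T (f a)) a := by
  induction k with
  | zero => simp [rowDiff_zero]
  | succ k ih =>
    obtain _ | ⟨a, b⟩ := a
    rw [rowDiff_succ, rowDiff_succ, map_add, h, ih, neg_add]

theorem map_detMap (T : L →+ L') (h : ∀ r u, T (D r u) = D' r (T u)) (k : ℕ) (u : L) :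
    T (detMap D k u) = detMap D' k (T u) := by
  induction k generalizing u with
  | zero => rfl
  | succ k ih => rw [detMap_succ, detMap_succ, ih, h]

variable {D} (hD : ∀ r s u, D r (D s u) = -D s (D r u)) (hD2 : ∀ r u, D r (D r u) = 0)

include hD hD2 in
theorem rowDiff_rowDiff (k : ℕ) (f : RowExp k → L) : rowDiff D k (rowDiff D k f) = 0 := by
  induction k with
  | zero => rfl
  | succ k ih =>
    funext x
    obtain _ | ⟨a, b⟩ := x
    have e1 : (fun a' => rowDiff D (k + 1) f (.snoc a' b)) =
        rowDiff D k (fun a' => f (.snoc a' b)) +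
          fun a' => D (k + 1) (f (.snoc a' (b + 1))) := rfl
    have e2 := map_rowDiff_neg D D (D (k + 1)).toAddMonoidHom (fun r u => hD _ _ _) k
      (fun a' => f (.snoc a' (b + 1))) a
    simp only [LinearMap.toAddMonoidHom_coe] at e2
    rw [rowDiff_succ, rowDiff_succ, e1, map_add, ih, map_add, hD2, add_zero, e2]
    simp

include hD hD2 in
theorem detMap_rowDiff (k : ℕ) (f : RowExp k → L) :
    detMap D k (rowDiff D k f (RowExp.zero k)) = 0 := by
  induction k with
  | zero => rfl
  | succ k ih =>
    change detMap D (k + 1) (rowDiff D (k + 1) f (.snoc (RowExp.zero k) 0)) = 0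
    have e2 := map_rowDiff_neg D D (D (k + 1)).toAddMonoidHom (fun r u => hD _ _ _) k
      (fun a' => f (.snoc a' 0)) (RowExp.zero k)
    simp only [LinearMap.toAddMonoidHom_coe] at e2
    rw [detMap_succ, rowDiff_succ, map_add, hD2, add_zero, e2, map_neg, ih, neg_zero]

theorem rowDiff_apply_eq_zero (D : ℕ → L →ₗ[S] L) {k p : ℕ} {f : RowExp k → L}
    (hf : ∀ a, a.size = p + 1 → f a = 0) {a : RowExp k} (ha : a.size = p) :
    rowDiff D k f a = 0 := by
  induction k generalizing p with
  | zero => rfl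
  | succ k ih =>
    obtain _ | ⟨a, b⟩ := a
    have ha' : a.size + b = p := ha
    have h1 : f (.snoc a (b + 1)) = 0 := hf _ (show a.size + (b + 1) = p + 1 by omega)
    rw [rowDiff_succ, h1, map_zero, add_zero]
    exact ih (fun a' h => hf _ (by rw [RowExp.size_snoc, h]; omega)) (rfl : a.size = a.size)

theorem rowDiff_apply_mem {D : ℕ → L →ₗ[S] L} {A B : Submodule S L} (h : ∀ r, ∀ u ∈ A, D (r + 1) u ∈ B)
    {k : ℕ} {f : RowExp k → L} (hf : ∀ a, f a ∈ A) (a : RowExp k) : rowDiff D k f a ∈ B := by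
  induction k with
  | zero => exact zero_mem _
  | succ k ih =>
    obtain _ | ⟨a, b⟩ := a
    exact add_mem (ih (fun a' => hf _) a) (h _ _ (hf _))

variable (G : ℕ → Submodule S L)

/-- Functions supported on exponent vectors of size `p` with values in the degree `q` part. -/
def bihomog (k q p : ℕ) : Submodule S (RowExp k → L) where
  carrier := {f | ∀ a, f a ∈ G q ∧ (a.size ≠ p → f a = 0)}
  add_mem' hf hg a := ⟨add_mem (hf a).1 (hg a).1, fun h => by simp [(hf a).2 h, (hg a).2 h]⟩
  zero_mem' a := ⟨zero_mem _, fun _ => rfl⟩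
  smul_mem' c f hf a := ⟨Submodule.smul_mem _ c (hf a).1, fun h => by simp [(hf a).2 h]⟩

theorem comp_mem_bihomog {G : ℕ → Submodule S L} {G' : ℕ → Submodule S L'} {k q q' p : ℕ}
    (T : L →ₗ[S] L') (hT : ∀ u ∈ G q, T u ∈ G' q') {f : RowExp k → L} (hf : f ∈ bihomog G k q p) :
    (fun a => T (f a)) ∈ bihomog G' k q' p := fun a =>
  ⟨hT _ (hf a).1, fun h => (congr_arg T ((hf a).2 h)).trans (map_zero T)⟩

variable {G} (hG : ∀ r q u, u ∈ G (q + 1) → D r u ∈ G q)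

include hG in
theorem rowDiff_mem {k q p : ℕ} {f : RowExp k → L} (hf : f ∈ bihomog G k (q + 1) (p + 1)) :
    rowDiff D k f ∈ bihomog G k q p := fun a =>
  ⟨rowDiff_apply_mem (fun r u hu => hG (r + 1) q u hu) (fun a => (hf a).1) a, fun h =>
    rowDiff_apply_eq_zero D (fun a' h' => (hf a').2 fun h'' => h (by omega)) rfl⟩

include hG in
theorem detMap_mem {k q : ℕ} {u : L} (hu : u ∈ G (q + k)) : detMap D k u ∈ G q := by
  induction k generalizing u with
  | zero => exact hu
  | succ k ih => exact ih (hG _ _ _ hu)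

variable (D G) in
/-- The complex with terms `bihomog G k (k + p) p`, augmented by `detMap`, is acyclic. -/
def IsRowExact (k : ℕ) : Prop :=
  (∀ p, ∀ f ∈ bihomog G k (k + p + 1) (p + 1), rowDiff D k f = 0 →
    ∃ g ∈ bihomog G k (k + p + 2) (p + 2), rowDiff D k g = f) ∧
  ∀ u ∈ G k, detMap D k u = 0 → ∃ g ∈ bihomog G k (k + 1) 1, rowDiff D k g (RowExp.zero k) = u

theorem isRowExact_zero : IsRowExact D G 0 := by
  refine ⟨fun p f hf _ => ⟨0, zero_mem _, ?_⟩, fun u _ hu => ⟨0, zero_mem _, ?_⟩⟩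
  · funext x
    cases x
    exact ((hf .nil).2 (Nat.succ_ne_zero p).symm).symm
  · exact (show u = 0 from hu).symm

/-- Extending a function by zero to exponent vectors with an additional row. -/
def extendRow {k : ℕ} (f : RowExp k → L) : RowExp (k + 1) → L
  | .snoc a 0 => f a
  | .snoc _ (_ + 1) => 0

/-- Shifting a function by the last divided power variable. -/
def shiftRow {k : ℕ} (f : RowExp (k + 1) → L) : RowExp (k + 1) → L
  | .snoc _ 0 => 0
  | .snoc a (b + 1) => f (.snoc a b)

theorem extendRow_mem {k q p : ℕ} {f : RowExp k → L} (hf : f ∈ bihomog G k q p) :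
    extendRow f ∈ bihomog G (k + 1) q p
  | .snoc a 0 => hf a
  | .snoc _ (_ + 1) => ⟨zero_mem _, fun _ => rfl⟩

theorem shiftRow_mem {k q p : ℕ} {f : RowExp (k + 1) → L} (hf : f ∈ bihomog G (k + 1) q p) :
    shiftRow f ∈ bihomog G (k + 1) q (p + 1)
  | .snoc _ 0 => ⟨zero_mem _, fun _ => rfl⟩
  | .snoc a (b + 1) => ⟨(hf (.snoc a b)).1, fun h => (hf (.snoc a b)).2 fun h' => h (by
      have : a.size + b = p := h'
      change a.size + (b + 1) = p + 1
      omega)⟩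

theorem rowDiff_extendRow {k : ℕ} (f : RowExp k → L) :
    rowDiff D (k + 1) (extendRow f) = extendRow (rowDiff D k f) := by
  funext x
  obtain _ | ⟨a, b⟩ := x
  rw [rowDiff_succ]
  cases b with
  | zero => simp [extendRow]
  | succ b =>
    have : (fun a' : RowExp k => extendRow f (.snoc a' (b + 1))) = 0 := rfl
    rw [this, map_zero]
    simp [extendRow]

theorem rowDiff_shiftRow_snoc_succ {k : ℕ} (f : RowExp (k + 1) → L) (a : RowExp k) (b : ℕ) :
    rowDiff D (k + 1) (shiftRow f) (.snoc a (b + 1)) = rowDiff D (k + 1) f (.snoc a b) := by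
  rw [rowDiff_succ, rowDiff_succ]
  rfl

theorem rowDiff_shiftRow_snoc_zero {k : ℕ} (f : RowExp (k + 1) → L) (a : RowExp k) :
    rowDiff D (k + 1) (shiftRow f) (.snoc a 0) = D (k + 1) (f (.snoc a 0)) := by
  rw [rowDiff_succ]
  have : (fun a' : RowExp k => shiftRow f (.snoc a' 0)) = 0 := rfl
  rw [this, map_zero, Pi.zero_apply, zero_add]
  rfl

theorem IsRowExact.exists_of_detMap_eq {k : ℕ} (h0 : IsRowExact D G k) {u v : L}
    (hG : ∀ r q u, u ∈ G (q + 1) → D r u ∈ G q)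
    (hu : u ∈ G k) (hv : v ∈ G (k + 1)) (huv : detMap D k u = detMap D (k + 1) v) :
    ∃ g ∈ bihomog G (k + 1) (k + 1) 1, rowDiff D (k + 1) g (RowExp.zero (k + 1)) = u := by
  classical
  obtain ⟨g, hg, hgu⟩ := h0.2 (u - D (k + 1) v) (sub_mem hu (hG _ _ _ hv))
    (by rw [map_sub, huv, detMap_succ, sub_self])
  have hs : (fun a => if a = RowExp.zero (k + 1) then v else 0) ∈ bihomog G (k + 1) (k + 1) 0 := by
    intro a
    dsimp only
    split_ifs with h
    · exact ⟨hv, fun h' => absurd (h ▸ RowExp.size_zero _) h'⟩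
    · exact ⟨zero_mem _, fun _ => rfl⟩
  refine ⟨extendRow g + shiftRow fun a => if a = RowExp.zero (k + 1) then v else 0,
    add_mem (extendRow_mem hg) (shiftRow_mem hs), ?_⟩
  change rowDiff D (k + 1) _ (.snoc (RowExp.zero k) 0) = u
  rw [map_add, Pi.add_apply, rowDiff_extendRow, rowDiff_shiftRow_snoc_zero]
  change rowDiff D k g (RowExp.zero k) + D (k + 1) (if RowExp.zero (k + 1) = _ then v else 0) = u
  rw [hgu, if_pos rfl, sub_add_cancel]

include hD hD2 in
theorem IsRowExact.exists_rowDiff_eq {k : ℕ} (h0 : IsRowExact D G k) (h1 : IsRowExact D G (k + 1))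
    (hG : ∀ r q u, u ∈ G (q + 1) → D r u ∈ G q) {p : ℕ} {f : RowExp (k + 1) → L}
    (hf : f ∈ bihomog G (k + 1) (k + p + 1) (p + 1)) (hdf : rowDiff D (k + 1) f = 0) :
    ∃ g ∈ bihomog G (k + 1) (k + p + 2) (p + 2), rowDiff D (k + 1) g = f := by
  obtain ⟨v, hv, hvf⟩ : ∃ v ∈ bihomog G (k + 1) (k + p + 2) (p + 1),
      ∀ a b, rowDiff D (k + 1) v (.snoc a b) = f (.snoc a (b + 1)) := by
    have hw : (fun | .snoc a b => f (.snoc a (b + 1)) : RowExp (k + 1) → L) ∈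
        bihomog G (k + 1) (k + p + 1) p
      | .snoc a b => ⟨(hf (.snoc a (b + 1))).1, fun h => (hf (.snoc a (b + 1))).2 fun h' => h (by
          have : a.size + (b + 1) = p + 1 := h'
          change a.size + b = p
          omega)⟩
    have hdw : rowDiff D (k + 1) (fun | .snoc a b => f (.snoc a (b + 1))) = 0 := by
      funext x
      obtain _ | ⟨a, b⟩ := x
      exact congr_fun hdf (.snoc a (b + 1))
    cases p with
    | zero =>
      have hz := congr_fun hdf (.snoc (RowExp.zero k) 0)
      rw [rowDiff_succ, Pi.zero_apply] at hz
      have hη := congr_arg (detMap D k) hz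
      rw [map_add, detMap_rowDiff hD hD2, zero_add, map_zero, ← detMap_succ] at hη
      obtain ⟨v, hv, hvf⟩ := h1.2 _ (hf _).1 hη
      refine ⟨v, hv, fun a b => ?_⟩
      by_cases h : a.size + b = 0
      · obtain rfl : b = 0 := by omega
        rw [RowExp.eq_zero_of_size_eq_zero a (by omega)]
        exact hvf
      · rw [(hf (.snoc a (b + 1))).2 (by rw [RowExp.size_snoc]; omega)]
        exact ((rowDiff_mem hG hv) (.snoc a b)).2 h
    | succ p =>
      have e1 : k + (p + 1) + 1 = k + 1 + p + 1 := by omega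
      have e2 : k + (p + 1) + 2 = k + 1 + p + 2 := by omega
      rw [e1] at hw
      rw [e2]
      obtain ⟨v, hv, hvf⟩ := h1.1 p _ hw hdw
      exact ⟨v, hv, fun a b => congr_fun hvf (.snoc a b)⟩
  set f' : RowExp (k + 1) → L := f - rowDiff D (k + 1) (shiftRow v) with hf'
  have hf'm : f' ∈ bihomog G (k + 1) (k + p + 1) (p + 1) :=
    sub_mem hf (rowDiff_mem hG (shiftRow_mem hv))
  have hdf' : rowDiff D (k + 1) f' = 0 := by
    rw [hf', map_sub, hdf, rowDiff_rowDiff hD hD2, sub_zero]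
  have hsucc : ∀ a b, f' (.snoc a (b + 1)) = 0 := fun a b => by
    rw [hf', Pi.sub_apply, rowDiff_shiftRow_snoc_succ, hvf, sub_self]
  have hext : f' = extendRow fun a => f' (.snoc a 0) := by
    funext x
    obtain _ | ⟨a, b⟩ := x
    cases b with
    | zero => rfl
    | succ b => exact hsucc a b
  obtain ⟨g, hg, hgf⟩ := h0.1 p (fun a => f' (.snoc a 0)) (fun a => hf'm (.snoc a 0)) (by
    funext a
    have := congr_fun hdf' (.snoc a 0)
    rwa [rowDiff_succ, hsucc, map_zero, add_zero] at this)
  refine ⟨extendRow g + shiftRow v, add_mem (extendRow_mem hg) (shiftRow_mem hv), ?_⟩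
  rw [map_add, rowDiff_extendRow, hgf, ← hext, hf', sub_add_cancel]

end RowDiff

/-! ### The exterior algebra on the columns -/

/-- Subsets of a set of `m` columns. -/
inductive ColSet : ℕ → Type
  | nil : ColSet 0
  | skip {m : ℕ} (t : ColSet m) : ColSet (m + 1)
  | take {m : ℕ} (t : ColSet m) : ColSet (m + 1)

namespace ColSet

/-- The number of elements of a set of columns. -/
def card : ∀ {m}, ColSet m → ℕ
  | _, nil => 0
  | _, skip t => card t
  | _, take t => card t + 1

/-- The empty set of columns. -/
def empty : ∀ m, ColSet m
  | 0 => nil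
  | m + 1 => skip (empty m)

theorem card_take {m} (t : ColSet m) : (take t).card = t.card + 1 := rfl

theorem card_empty : ∀ m, (empty m).card = 0
  | 0 => rfl
  | m + 1 => card_empty m

theorem eq_empty_of_card_eq_zero : ∀ {m} (t : ColSet m), t.card = 0 → t = empty m
  | _, nil, _ => rfl
  | _, skip t, h => by rw [eq_empty_of_card_eq_zero t h]; rfl
  | _, take t, h => absurd h (Nat.succ_ne_zero _)

instance instFinite : ∀ m, Finite (ColSet m)
  | 0 => Finite.of_surjective (fun _ : Unit => nil) fun | nil => ⟨(), rfl⟩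
  | m + 1 => by
    have := instFinite m
    exact Finite.of_surjective (Sum.elim skip take : ColSet m ⊕ ColSet m → _) fun
      | skip t => ⟨.inl t, rfl⟩
      | take t => ⟨.inr t, rfl⟩

end ColSet

section Contraction

variable {S : Type*} [CommRing S]

/-- Contraction of the exterior algebra on `m` columns with the linear form `c`. -/
def contr (c : ℕ → S) : ∀ m, (ColSet m → S) →ₗ[S] (ColSet m → S)
  | 0 => 0
  | m + 1 => LinearMap.pi fun
    | .skip t => LinearMap.proj t ∘ₗ contr c m ∘ₗ LinearMap.funLeft S S .skip
        + c m • LinearMap.proj (.take t)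
    | .take t => -(LinearMap.proj t ∘ₗ contr c m ∘ₗ LinearMap.funLeft S S .take)

/-- The elements of the exterior algebra not involving the last column. -/
def inclSkip (m : ℕ) : (ColSet m → S) →ₗ[S] (ColSet (m + 1) → S) :=
  LinearMap.pi fun
    | .skip t => LinearMap.proj t
    | .take _ => 0

/-- Left multiplication of the elements not involving the last column by the last column. -/
def inclTake (m : ℕ) : (ColSet m → S) →ₗ[S] (ColSet (m + 1) → S) :=
  LinearMap.pi fun
    | .skip _ => 0
    | .take t => LinearMap.proj t

/-- The component not involving the last column. -/
def projSkip (m : ℕ) : (ColSet (m + 1) → S) →ₗ[S] (ColSet m → S) := LinearMap.funLeft S S .skip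

/-- The component involving the last column. -/
def projTake (m : ℕ) : (ColSet (m + 1) → S) →ₗ[S] (ColSet m → S) := LinearMap.funLeft S S .take

variable {m : ℕ}

theorem inclSkip_add_inclTake (f : ColSet (m + 1) → S) :
    inclSkip m (projSkip m f) + inclTake m (projTake m f) = f := by
  funext t
  cases t with
  | skip t => exact add_zero _
  | take t => exact zero_add _

theorem projSkip_inclSkip (f : ColSet m → S) : projSkip m (inclSkip m f) = f := rfl

theorem projTake_inclTake (f : ColSet m → S) : projTake m (inclTake m f) = f := rfl

theorem projSkip_inclTake (f : ColSet m → S) : projSkip m (inclTake m f) = 0 := rfl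

theorem projTake_inclSkip (f : ColSet m → S) : projTake m (inclSkip m f) = 0 := rfl

theorem ext_proj {f g : ColSet (m + 1) → S} (h1 : projSkip m f = projSkip m g)
    (h2 : projTake m f = projTake m g) : f = g := by
  rw [← inclSkip_add_inclTake f, h1, h2, inclSkip_add_inclTake]

variable (c c' : ℕ → S)

theorem projSkip_contr (f : ColSet (m + 1) → S) :
    projSkip m (contr c (m + 1) f) = contr c m (projSkip m f) + c m • projTake m f := rfl

theorem projTake_contr (f : ColSet (m + 1) → S) :
    projTake m (contr c (m + 1) f) = -contr c m (projTake m f) := rfl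

theorem contr_inclSkip (f : ColSet m → S) :
    contr c (m + 1) (inclSkip m f) = inclSkip m (contr c m f) := by
  refine ext_proj ?_ ?_
  · rw [projSkip_contr, projSkip_inclSkip, projTake_inclSkip, smul_zero, add_zero,
      projSkip_inclSkip]
  · rw [projTake_contr, projTake_inclSkip, map_zero, neg_zero, projTake_inclSkip]

theorem contr_inclTake (f : ColSet m → S) :
    contr c (m + 1) (inclTake m f) = inclSkip m (c m • f) - inclTake m (contr c m f) := by
  refine ext_proj ?_ ?_
  · rw [projSkip_contr, projSkip_inclTake, projTake_inclTake, map_zero, zero_add, map_sub,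
      projSkip_inclSkip, projSkip_inclTake, sub_zero]
  · rw [projTake_contr, projTake_inclTake, map_sub, projTake_inclSkip, projTake_inclTake, zero_sub]

theorem contr_contr_self (f : ColSet m → S) : contr c m (contr c m f) = 0 := by
  induction m with
  | zero => rfl
  | succ m ih =>
    refine ext_proj ?_ ?_
    · rw [projSkip_contr, projSkip_contr, projTake_contr, map_add, ih, map_smul, map_zero]
      simp
    · rw [projTake_contr, projTake_contr, map_neg, ih]
      simp

theorem contr_contr (f : ColSet m → S) : contr c m (contr c' m f) = -contr c' m (contr c m f) := by
  induction m with
  | zero => exact neg_zero.symm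
  | succ m ih =>
    refine ext_proj ?_ ?_
    · rw [map_neg, projSkip_contr, projSkip_contr, projTake_contr, projSkip_contr, projSkip_contr,
        projTake_contr, map_add, map_add, ih (projSkip m f)]
      simp only [map_smul, smul_neg]
      abel
    · rw [map_neg, projTake_contr, projTake_contr, projTake_contr, projTake_contr, map_neg, map_neg,
        ih (projTake m f)]

variable (S m) in
/-- The part of exterior degree `q`. -/
def extDeg (q : ℕ) : Submodule S (ColSet m → S) where
  carrier := {f | ∀ t, t.card ≠ q → f t = 0}
  add_mem' hf hg t ht := by simp [hf t ht, hg t ht]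
  zero_mem' _ _ := rfl
  smul_mem' c f hf t ht := by simp [hf t ht]

theorem projSkip_mem {q : ℕ} {f : ColSet (m + 1) → S} (hf : f ∈ extDeg S (m + 1) q) :
    projSkip m f ∈ extDeg S m q := fun t ht => hf (.skip t) ht

theorem projTake_mem {q : ℕ} {f : ColSet (m + 1) → S} (hf : f ∈ extDeg S (m + 1) (q + 1)) :
    projTake m f ∈ extDeg S m q := fun t ht => hf (.take t) (by rw [ColSet.card_take]; omega)

theorem inclSkip_mem {q : ℕ} {f : ColSet m → S} (hf : f ∈ extDeg S m q) :
    inclSkip m f ∈ extDeg S (m + 1) q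
  | .skip t, ht => hf t ht
  | .take _, _ => rfl

theorem inclTake_mem {q : ℕ} {f : ColSet m → S} (hf : f ∈ extDeg S m q) :
    inclTake m f ∈ extDeg S (m + 1) (q + 1)
  | .skip _, _ => rfl
  | .take t, ht => hf t fun h => ht (by rw [ColSet.card_take, h])

theorem contr_eq_zero {f : ColSet m → S} (hf : f ∈ extDeg S m 0) : contr c m f = 0 := by
  induction m with
  | zero => rfl
  | succ m ih =>
    have h : projTake m f = 0 := funext fun t => hf _ (by rw [ColSet.card_take]; omega)
    refine ext_proj ?_ ?_
    · rw [projSkip_contr, ih (projSkip_mem hf), h, smul_zero, add_zero, map_zero]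
    · rw [projTake_contr, h, map_zero, map_zero, neg_zero]

theorem contr_mem {q : ℕ} {f : ColSet m → S} (hf : f ∈ extDeg S m (q + 1)) :
    contr c m f ∈ extDeg S m q := by
  induction m generalizing q with
  | zero => exact zero_mem _
  | succ m ih =>
    rw [← inclSkip_add_inclTake f, map_add, contr_inclSkip, contr_inclTake]
    refine add_mem (inclSkip_mem (ih (projSkip_mem hf)))
      (sub_mem (inclSkip_mem (Submodule.smul_mem _ _ (projTake_mem hf))) ?_)
    cases q with
    | zero =>
      have h0 := contr_eq_zero c (projTake_mem hf)
      rw [h0, map_zero]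
      exact zero_mem _
    | succ q => exact inclTake_mem (ih (projTake_mem hf))

end Contraction

section RowExact

/-- In the ring `S`, the element `z` is a polynomial variable over a subring containing `y s` for
all `s < m`; here `coe e` extracts the coefficient of `z ^ e`. -/
def IsFreeVariable {S : Type*} [CommRing S] (y : ℕ → S) (m : ℕ) (z : S) : Prop :=
  ∃ coe : ℕ → S →+ S,
    (∀ e, ∀ s < m, ∀ x, coe e (y s * x) = y s * coe e x) ∧
    (∀ e x, coe (e + 1) (z * x) = coe e x) ∧
    (∀ x, coe 0 (z * x) = 0) ∧
    (∀ x, ∃ N, ∀ e, N ≤ e → coe e x = 0) ∧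
    (∀ x, (∀ e, coe e x = 0) → x = 0) ∧
    ∀ e e' x, coe e (coe e' x) = if e = 0 then coe e' x else 0

open Polynomial in
theorem isFreeVariable_of_ringEquiv {S A : Type*} [CommRing S] [CommRing A] (ψ : S ≃+* A[X])
    {y : ℕ → S} {m : ℕ} {z : S} (hz : ψ z = Polynomial.X)
    (hy : ∀ s < m, ∃ a, ψ (y s) = Polynomial.C a) :
    IsFreeVariable y m z := by
  refine ⟨fun e => ψ.symm.toAddMonoidHom.comp (Polynomial.C.toAddMonoidHom.comp
    ((lcoeff A e).toAddMonoidHom.comp ψ.toAddMonoidHom)), ?_, ?_, ?_, ?_, ?_, ?_⟩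
  · intro e s hs x
    obtain ⟨a, ha⟩ := hy s hs
    apply ψ.injective
    simp [ha]
  · intro e x
    simp [hz]
  · intro x
    simp [hz]
  · intro x
    refine ⟨(ψ x).natDegree + 1, fun e he => ?_⟩
    simp [coeff_eq_zero_of_natDegree_lt (show (ψ x).natDegree < e by omega)]
  · intro x hx
    apply ψ.injective
    ext e
    simpa using hx e
  · intro e e' x
    by_cases h : e = 0
    · simp [h]
    · simp [h, Polynomial.coeff_C]

variable {S : Type*} [CommRing S] (y : ℕ → S)

/-- Contractions with the rows of the matrix of powers of the elements `y s`. -/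
def powContr (m r : ℕ) : (ColSet m → S) →ₗ[S] (ColSet m → S) := contr (fun s => y s ^ r) m

variable {y} {m : ℕ}

theorem powContr_comm (r s : ℕ) (u : ColSet m → S) :
    powContr y m r (powContr y m s u) = -powContr y m s (powContr y m r u) := contr_contr _ _ _

theorem powContr_self (r : ℕ) (u : ColSet m → S) : powContr y m r (powContr y m r u) = 0 :=
  contr_contr_self _ _

theorem powContr_mem (r q : ℕ) (u : ColSet m → S) (hu : u ∈ extDeg S m (q + 1)) :
    powContr y m r u ∈ extDeg S m q := contr_mem _ hu

theorem powContr_inclSkip (r : ℕ) (f : ColSet m → S) :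
    powContr y (m + 1) r (inclSkip m f) = inclSkip m (powContr y m r f) := contr_inclSkip _ _

theorem powContr_inclTake (r : ℕ) (f : ColSet m → S) :
    powContr y (m + 1) r (inclTake m f) =
      inclSkip m (y m ^ r • f) - inclTake m (powContr y m r f) := contr_inclTake _ _

theorem projTake_powContr (r : ℕ) (f : ColSet (m + 1) → S) :
    projTake m (powContr y (m + 1) r f) = -powContr y m r (projTake m f) := projTake_contr _ _

theorem detMap_inclSkip (k : ℕ) (u : ColSet m → S) :
    detMap (powContr y (m + 1)) k (inclSkip m u) = inclSkip m (detMap (powContr y m) k u) :=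
  (map_detMap _ _ (inclSkip m).toAddMonoidHom (fun _ _ => (powContr_inclSkip _ _).symm) k u).symm

theorem rowDiff_inclSkip (k : ℕ) (f : RowExp k → ColSet m → S) (a : RowExp k) :
    rowDiff (powContr y (m + 1)) k (fun a => inclSkip m (f a)) a =
      inclSkip m (rowDiff (powContr y m) k f a) :=
  (map_rowDiff _ _ (inclSkip m).toAddMonoidHom (fun _ _ => (powContr_inclSkip _ _).symm) k f a).symm

theorem projTake_rowDiff (k : ℕ) (f : RowExp k → ColSet (m + 1) → S) (a : RowExp k) :
    projTake m (rowDiff (powContr y (m + 1)) k f a) =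
      -rowDiff (powContr y m) k (fun a => projTake m (f a)) a :=
  map_rowDiff_neg _ _ (projTake m).toAddMonoidHom (fun _ _ => projTake_powContr _ _) k f a

theorem projSkip_detMap_inclTake_succ (k : ℕ) (w : ColSet m → S) :
    projSkip m (detMap (powContr y (m + 1)) (k + 1) (inclTake m w)) =
      y m ^ (k + 1) • detMap (powContr y m) k w -
        projSkip m (detMap (powContr y (m + 1)) k (inclTake m (powContr y m (k + 1) w))) := by
  rw [detMap_succ, powContr_inclTake, map_sub, detMap_inclSkip, map_sub, projSkip_inclSkip, map_smul]

theorem detMap_rowDiff_inclTake {k : ℕ} {g : RowExp k → ColSet m → S} {p : ℕ}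
    (hg : g ∈ bihomog (extDeg S m) k p 1) :
    ∃ v ∈ extDeg S m p,
      projSkip m (detMap (powContr y (m + 1)) k
        (inclTake m (rowDiff (powContr y m) k g (RowExp.zero k)))) = detMap (powContr y m) k v := by
  have hv : rowDiff (powContr y (m + 1)) k (fun a => inclTake m (g a)) (RowExp.zero k) ∈
      extDeg S (m + 1) p :=
    rowDiff_apply_mem (A := extDeg S (m + 1) (p + 1)) (fun r u => powContr_mem (r + 1) p u)
      (fun a => inclTake_mem (hg a).1) _
  have h := detMap_rowDiff (D := powContr y (m + 1)) powContr_comm powContr_self k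
    (fun a => inclTake m (g a))
  refine ⟨_, projSkip_mem hv, ?_⟩
  rw [← inclSkip_add_inclTake (rowDiff (powContr y (m + 1)) k _ _), projTake_rowDiff, map_add,
    detMap_inclSkip, map_neg, map_neg] at h
  have h' := congr_arg (projSkip m) h
  rw [map_add, projSkip_inclSkip, map_neg, map_zero, add_neg_eq_zero] at h'
  exact h'.symm

theorem exists_rowDiff_of_projSkip_detMap {k : ℕ} (hfree : IsFreeVariable y m (y m))
    (h0 : IsRowExact (powContr y m) (extDeg S m) k) {w v : ColSet m → S}
    (hw : w ∈ extDeg S m k) (hv : v ∈ extDeg S m (k + 1))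
    (hwv : projSkip m (detMap (powContr y (m + 1)) (k + 1) (inclTake m w)) =
      detMap (powContr y m) (k + 1) v) :
    ∃ g ∈ bihomog (extDeg S m) (k + 1) (k + 1) 1,
      rowDiff (powContr y m) (k + 1) g (RowExp.zero (k + 1)) = w := by
  obtain ⟨coe, hy, hz, hz0, hfin, hext, hcc⟩ := hfree
  let T : ℕ → (ColSet m → S) →+ (ColSet m → S) := fun e => (coe e).compLeft (ColSet m)
  have hpow : ∀ e, ∀ s < m, ∀ r x, coe e (y s ^ r * x) = y s ^ r * coe e x := fun e s hs r => by
    induction r with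
    | zero => simp
    | succ r ih => intro x; rw [pow_succ, mul_assoc, ih, hy e s hs, mul_assoc]
  have hTc : ∀ e (c : ℕ → S), ∀ m', (∀ s < m', ∀ x, coe e (c s * x) = c s * coe e x) →
      ∀ u, (coe e).compLeft (ColSet m') (contr c m' u) =
        contr c m' ((coe e).compLeft (ColSet m') u) := by
    intro e c m'
    induction m' with
    | zero => intro _ u; exact map_zero _
    | succ m' ih =>
      intro hc u
      have ih' := ih fun s hs => hc s (by omega)
      funext t
      cases t with
      | skip t =>
        have h1 := congr_fun (ih' (projSkip m' u)) t
        change coe e (contr c m' (projSkip m' u) t + c m' * u (.take t)) = _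
        rw [map_add, hc m' (by omega)]
        exact congr_arg (· + _) h1
      | take t =>
        have h1 := congr_fun (ih' (projTake m' u)) t
        change coe e (-contr c m' (projTake m' u) t) = _
        rw [map_neg]
        exact congr_arg (-·) h1
  have hTp : ∀ e r u, T e (powContr y m r u) = powContr y m r (T e u) := fun e r u =>
    hTc e _ m (fun s hs x => hpow e s hs r x) u
  have hTd : ∀ e k u, T e (detMap (powContr y m) k u) = detMap (powContr y m) k (T e u) :=
    fun e k u => map_detMap _ _ (T e) (hTp e) k u
  have hTz : ∀ e r u, T (e + r) (y m ^ r • u) = T e u := fun e r => by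
    induction r with
    | zero => intro u; simp
    | succ r ih =>
      intro u
      rw [← ih u]
      funext t
      change coe (e + r + 1) (y m ^ (r + 1) * u t) = coe (e + r) (y m ^ r * u t)
      rw [pow_succ', mul_assoc, hz]
  have hTz0 : ∀ r e u, e < r → T e (y m ^ r • u) = 0 := fun r => by
    induction r with
    | zero => intro e u h; omega
    | succ r ih =>
      intro e u h
      funext t
      change coe e (y m ^ (r + 1) * u t) = 0
      rw [pow_succ', mul_assoc]
      cases e with
      | zero => exact hz0 _
      | succ e => rw [hz]; exact congr_fun (ih e u (by omega)) t
  have hlead : ∀ k N (w : ColSet m → S), (∀ e, N ≤ e → T e w = 0) → ∀ e, N + k ≤ e →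
      T e (projSkip m (detMap (powContr y (m + 1)) k (inclTake m w))) = 0 := by
    intro k
    induction k with
    | zero => intro N w _ e _; exact map_zero _
    | succ k ih =>
      intro N w hw e he
      rw [projSkip_detMap_inclTake_succ, map_sub, ih N _ _ e (by omega), sub_zero]
      · obtain ⟨e, rfl⟩ : ∃ e', e = e' + (k + 1) := ⟨e - (k + 1), by omega⟩
        rw [hTz, hTd, hw e (by omega), map_zero]
      · intro e he
        rw [hTp, hw e he, map_zero]
  have hTmem : ∀ e q u, u ∈ extDeg S m q → T e u ∈ extDeg S m q := fun e q u hu t ht => by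
    change coe e (u t) = 0
    rw [hu t ht, map_zero]
  suffices H : ∀ N (w v : ColSet m → S), w ∈ extDeg S m k → v ∈ extDeg S m (k + 1) →
      (∀ e, N ≤ e → T e w = 0) →
      projSkip m (detMap (powContr y (m + 1)) (k + 1) (inclTake m w)) =
        detMap (powContr y m) (k + 1) v →
      ∃ g ∈ bihomog (extDeg S m) (k + 1) (k + 1) 1,
        rowDiff (powContr y m) (k + 1) g (RowExp.zero (k + 1)) = w by
    choose N hN using fun t => hfin (w t)
    have := Fintype.ofFinite (ColSet m)
    refine H (Finset.univ.sup N) w v hw hv (fun e he => funext fun t => hN t e ?_) hwv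
    exact (Finset.le_sup (Finset.mem_univ t)).trans he
  intro N
  induction N with
  | zero =>
    intro w v _ _ hN _
    refine ⟨0, zero_mem _, ?_⟩
    rw [map_zero]
    exact funext fun t => (hext _ fun e => congr_fun (hN e (Nat.zero_le _)) t).symm
  | succ N ih =>
    intro w v hw hv hN hwv
    have htop : detMap (powContr y m) k (T N w) =
        detMap (powContr y m) (k + 1) (T (N + (k + 1)) v) := by
      rw [← hTd, ← hTd, ← hwv, projSkip_detMap_inclTake_succ, map_sub, hTz,
        hlead k (N + 1) _ _ _ (by omega), sub_zero]
      intro e he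
      rw [hTp, hN e he, map_zero]
    obtain ⟨g, hg, hgw⟩ := h0.exists_of_detMap_eq powContr_mem (hTmem N k w hw)
      (hTmem _ _ v hv) htop
    obtain ⟨v', hv', hgv⟩ := detMap_rowDiff_inclTake hg
    rw [hgw] at hgv
    obtain ⟨g', hg', hgw'⟩ := ih (w - y m ^ N • T N w) (v - y m ^ N • v')
      (sub_mem hw (Submodule.smul_mem _ _ (hTmem N k w hw)))
      (sub_mem hv (Submodule.smul_mem _ _ hv'))
      (by
        intro e he
        rw [map_sub]
        obtain ⟨e, rfl⟩ : ∃ e', e = e' + N := ⟨e - N, by omega⟩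
        rw [hTz]
        have hTT : T e (T N w) = if e = 0 then T N w else 0 := by
          funext t
          change coe e (coe N (w t)) = _
          rw [hcc]
          split_ifs <;> rfl
        rw [hTT]
        split_ifs with h
        · rw [h, zero_add, sub_self]
        · rw [hN _ (by omega), sub_self])
      (by simp only [map_sub, map_smul, hwv, hgv])
    refine ⟨g' + y m ^ N • g, add_mem hg' (Submodule.smul_mem _ _ hg), ?_⟩
    rw [map_add, map_smul, Pi.add_apply, Pi.smul_apply, hgw', hgw, sub_add_cancel]

theorem exists_rowDiff_powContr_succ {k : ℕ} (h0 : IsRowExact (powContr y m) (extDeg S m) k)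
    (h1 : IsRowExact (powContr y m) (extDeg S m) (k + 1)) {p : ℕ}
    {f : RowExp (k + 1) → ColSet (m + 1) → S}
    (hf : f ∈ bihomog (extDeg S (m + 1)) (k + 1) (k + 1 + p + 1) (p + 1))
    (hdf : rowDiff (powContr y (m + 1)) (k + 1) f = 0) :
    ∃ g ∈ bihomog (extDeg S (m + 1)) (k + 1) (k + 1 + p + 2) (p + 2),
      rowDiff (powContr y (m + 1)) (k + 1) g = f := by
  have hw : (fun a => projTake m (f a)) ∈ bihomog (extDeg S m) (k + 1) (k + p + 1) (p + 1) := by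
    rw [show k + 1 + p + 1 = k + p + 1 + 1 by omega] at hf
    exact comp_mem_bihomog (projTake m) (fun _ => projTake_mem) hf
  have hdw : rowDiff (powContr y m) (k + 1) (fun a => projTake m (f a)) = 0 := by
    funext a
    have := projTake_rowDiff (y := y) (k + 1) f a
    rw [hdf, Pi.zero_apply, map_zero, zero_eq_neg] at this
    exact this
  obtain ⟨v, hv, hvf⟩ := h0.exists_rowDiff_eq powContr_comm powContr_self h1 powContr_mem hw hdw
  have hv' : (fun a => inclTake m (v a)) ∈
      bihomog (extDeg S (m + 1)) (k + 1) (k + 1 + p + 2) (p + 2) := by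
    rw [show k + 1 + p + 2 = k + p + 2 + 1 by omega]
    exact comp_mem_bihomog (inclTake m) (fun _ => inclTake_mem) hv
  set f' := f + rowDiff (powContr y (m + 1)) (k + 1) (fun a => inclTake m (v a)) with hf'
  have hf'm : f' ∈ bihomog (extDeg S (m + 1)) (k + 1) (k + 1 + p + 1) (p + 1) :=
    add_mem hf (rowDiff_mem powContr_mem hv')
  have hdf' : rowDiff (powContr y (m + 1)) (k + 1) f' = 0 := by
    rw [hf', map_add, hdf, rowDiff_rowDiff powContr_comm powContr_self, add_zero]
  have htake : ∀ a, projTake m (f' a) = 0 := by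
    intro a
    rw [hf', Pi.add_apply, map_add, projTake_rowDiff]
    change projTake m (f a) + -rowDiff (powContr y m) (k + 1) v a = 0
    rw [hvf, add_neg_cancel]
  have hincl : f' = fun a => inclSkip m (projSkip m (f' a)) := by
    funext a
    conv_lhs => rw [← inclSkip_add_inclTake (f' a), htake, map_zero, add_zero]
  obtain ⟨c, hc, hcf⟩ := h1.1 p (fun a => projSkip m (f' a))
    (comp_mem_bihomog (projSkip m) (fun _ => projSkip_mem) hf'm) (by
      funext a
      have := congr_fun hdf' a
      rw [hincl, rowDiff_inclSkip] at this
      exact congr_arg (projSkip m) this)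
  refine ⟨(fun a => inclSkip m (c a)) - fun a => inclTake m (v a), sub_mem
    (comp_mem_bihomog (inclSkip m) (fun _ => inclSkip_mem) hc) hv', ?_⟩
  have : rowDiff (powContr y (m + 1)) (k + 1) (fun a => inclSkip m (c a)) = f' := by
    rw [hincl]
    funext a
    rw [rowDiff_inclSkip, hcf]
  rw [map_sub, this, hf', add_sub_cancel_right]

theorem exists_rowDiff_zero_powContr_succ {k : ℕ} (hfree : IsFreeVariable y m (y m))
    (h0 : IsRowExact (powContr y m) (extDeg S m) k)
    (h1 : IsRowExact (powContr y m) (extDeg S m) (k + 1)) {u : ColSet (m + 1) → S}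
    (hu : u ∈ extDeg S (m + 1) (k + 1))
    (hdu : detMap (powContr y (m + 1)) (k + 1) u = 0) :
    ∃ g ∈ bihomog (extDeg S (m + 1)) (k + 1) (k + 1 + 1) 1,
      rowDiff (powContr y (m + 1)) (k + 1) g (RowExp.zero (k + 1)) = u := by
  have hsplit := hdu
  rw [← inclSkip_add_inclTake u, map_add, detMap_inclSkip] at hsplit
  have hs := congr_arg (projSkip m) hsplit
  rw [map_add, projSkip_inclSkip, map_zero, add_comm, add_eq_zero_iff_eq_neg, ← map_neg] at hs
  obtain ⟨g, hg, hgu⟩ := exists_rowDiff_of_projSkip_detMap hfree h0 (projTake_mem hu)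
    (neg_mem (projSkip_mem hu)) hs
  have hg' : (fun a => inclTake m (g a)) ∈
      bihomog (extDeg S (m + 1)) (k + 1) (k + 1 + 1) 1 :=
    comp_mem_bihomog (inclTake m) (fun _ => inclTake_mem) hg
  set u' := u + rowDiff (powContr y (m + 1)) (k + 1) (fun a => inclTake m (g a))
    (RowExp.zero (k + 1)) with hu'
  have hu'm : u' ∈ extDeg S (m + 1) (k + 1) :=
    add_mem hu ((rowDiff_mem powContr_mem hg') _).1
  have hdu' : detMap (powContr y (m + 1)) (k + 1) u' = 0 := by
    rw [hu', map_add, hdu, detMap_rowDiff powContr_comm powContr_self, add_zero]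
  have htake : projTake m u' = 0 := by
    rw [hu', map_add, projTake_rowDiff]
    change projTake m u + -rowDiff (powContr y m) (k + 1) g _ = 0
    rw [hgu, add_neg_cancel]
  have hincl : u' = inclSkip m (projSkip m u') := by
    conv_lhs => rw [← inclSkip_add_inclTake u', htake, map_zero, add_zero]
  obtain ⟨c, hc, hcu⟩ := h1.2 (projSkip m u') (projSkip_mem hu'm) (by
    rw [hincl, detMap_inclSkip] at hdu'
    exact congr_arg (projSkip m) hdu')
  have hc' : (fun a => inclSkip m (c a)) ∈
      bihomog (extDeg S (m + 1)) (k + 1) (k + 1 + 1) 1 :=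
    comp_mem_bihomog (inclSkip m) (fun _ => inclSkip_mem) hc
  refine ⟨(fun a => inclSkip m (c a)) - fun a => inclTake m (g a), sub_mem hc' hg', ?_⟩
  rw [map_sub, Pi.sub_apply, rowDiff_inclSkip, hcu, ← hincl, hu', add_sub_cancel_right]

theorem isRowExact_succ {k : ℕ} (hfree : IsFreeVariable y m (y m))
    (h0 : IsRowExact (powContr y m) (extDeg S m) k)
    (h1 : IsRowExact (powContr y m) (extDeg S m) (k + 1)) :
    IsRowExact (powContr y (m + 1)) (extDeg S (m + 1)) (k + 1) :=
  ⟨fun _ _ hf hdf => exists_rowDiff_powContr_succ h0 h1 hf hdf,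
    fun _ hu hdu => exists_rowDiff_zero_powContr_succ hfree h0 h1 hu hdu⟩

theorem isRowExact_zero_succ (k : ℕ) : IsRowExact (powContr y 0) (extDeg S 0) (k + 1) := by
  have hzero : ∀ q, ∀ u ∈ extDeg S 0 (q + 1), u = 0 := fun q u hu =>
    funext fun | .nil => hu .nil (Nat.succ_ne_zero q).symm
  refine ⟨fun p f hf _ => ⟨0, zero_mem _, ?_⟩, fun u hu _ => ⟨0, zero_mem _, ?_⟩⟩
  · rw [map_zero]
    exact funext fun a => (hzero _ _ (hf a).1).symm
  · rw [map_zero]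
    exact (hzero _ _ hu).symm

/-- The Eagon–Northcott complex of the matrix with rows `(y s) ^ r`, for `1 ≤ r ≤ k`, is acyclic
when the `y s` are independent variables. -/
theorem isRowExact_powContr (hfree : ∀ s < m, IsFreeVariable y s (y s)) (k : ℕ) :
    IsRowExact (powContr y m) (extDeg S m) k := by
  induction m generalizing k with
  | zero =>
    cases k with
    | zero => exact isRowExact_zero
    | succ k => exact isRowExact_zero_succ k
  | succ m ih =>
    cases k with
    | zero => exact isRowExact_zero
    | succ k =>
      exact isRowExact_succ (hfree m (by omega)) (ih (fun s hs => hfree s (by omega)) k)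
        (ih (fun s hs => hfree s (by omega)) (k + 1))

end RowExact

/-! ### Uniqueness of minimal graded free resolutions -/

section Uniqueness

variable {σ K : Type*} [Field K]

variable (σ K) in
/-- A family of subgroups `Y P` of a module over a polynomial ring, to be thought of as the sum of
the homogeneous components of degrees in `P` for some grading. -/
structure IsGradingFamily {M : Type*} [AddCommGroup M] [Module (MvPolynomial σ K) M]
    (Y : Set ℕ → AddSubgroup M) : Prop where
  mono : Monotone Y
  smul_mem : ∀ (c : σ →₀ ℕ) (a : K) (j : ℕ), ∀ y ∈ Y {j}, monomial c a • y ∈ Y {c.degree + j}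
  eq_zero : ∀ j, ∀ y ∈ Y {j}, y ∈ Y {j}ᶜ → y = 0

/-- The elements of a graded free module all of whose terms have degree in `P`. -/
def homogPart {ι : Type*} (deg : ι → ℕ) (P : Set ℕ) : AddSubgroup (ι →₀ MvPolynomial σ K) where
  carrier := {x | ∀ b c, coeff c (x b) ≠ 0 → c.degree + deg b ∈ P}
  add_mem' {x y} hx hy b c h := by
    by_contra h'
    refine h ?_
    rw [Finsupp.add_apply, coeff_add, not_not.1 fun h => h' (hx b c h),
      not_not.1 fun h => h' (hy b c h), add_zero]
  zero_mem' b c h := absurd (coeff_zero c) h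
  neg_mem' {x} hx b c h := hx b c fun h' => h (by rw [Finsupp.neg_apply, coeff_neg, h', neg_zero])

theorem single_one_mem_homogPart {ι : Type*} (deg : ι → ℕ) (b : ι) :
    (Finsupp.single b 1 : ι →₀ MvPolynomial σ K) ∈ homogPart deg {deg b} := by
  classical
  intro b' c h
  rw [Finsupp.single_apply] at h
  split_ifs at h with hb
  · rw [coeff_one] at h
    split_ifs at h with hc
    · simp [← hc, hb]
    · exact absurd rfl h
  · exact absurd (coeff_zero c) h

theorem isGradingFamily_homogPart {ι : Type*} (deg : ι → ℕ) :
    IsGradingFamily σ K (homogPart (σ := σ) (K := K) deg) where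
  mono _ _ h _ hx b c hc := h (hx b c hc)
  smul_mem c a j y hy b c' h := by
    classical
    rw [Finsupp.smul_apply, smul_eq_mul, coeff_monomial_mul'] at h
    split_ifs at h with hc
    · have := hy b _ (right_ne_zero_of_mul h)
      have hd : c'.degree = c.degree + (c' - c).degree := by
        rw [← map_add, add_tsub_cancel_of_le hc]
      rw [Set.mem_singleton_iff] at this ⊢
      omega
    · exact absurd rfl h
  eq_zero j y h1 h2 := by
    ext b c
    by_contra h
    exact h2 b c h (h1 b c h)

variable {M : Type*} [AddCommGroup M] [Module (MvPolynomial σ K) M] {Y : Set ℕ → AddSubgroup M}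
  {ι κ : Type*} {degι : ι → ℕ} {degκ : κ → ℕ}

theorem IsGradingFamily.map_mem (hY : IsGradingFamily σ K Y)
    {f : (ι →₀ MvPolynomial σ K) →ₗ[MvPolynomial σ K] M}
    (hf : ∀ b, f (Finsupp.single b 1) ∈ Y {degι b}) {P : Set ℕ} {x : ι →₀ MvPolynomial σ K}
    (hx : x ∈ homogPart degι P) : f x ∈ Y P := by
  have h1 : f x = x.sum fun b p => p • f (Finsupp.single b 1) := by
    conv_lhs => rw [← Finsupp.sum_single x]
    rw [map_finsuppSum]
    refine Finsupp.sum_congr fun b _ => ?_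
    rw [← map_smul, Finsupp.smul_single, smul_eq_mul, mul_one]
  rw [h1]
  refine sum_mem fun b _ => ?_
  dsimp only
  rw [(x b).as_sum, Finset.sum_smul]
  refine sum_mem fun c hc => ?_
  exact hY.mono (Set.singleton_subset_iff.2 (hx b c (mem_support_iff.1 hc)))
    (hY.smul_mem _ _ _ _ (hf b))

theorem exists_add_of_homogPart (degι : ι → ℕ) (P : Set ℕ) (x : ι →₀ MvPolynomial σ K) :
    ∃ y ∈ homogPart degι P, ∃ z ∈ homogPart degι Pᶜ, y + z = x := by
  rw [← AddSubgroup.mem_sup]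
  induction x using Finsupp.induction_linear with
  | zero => exact zero_mem _
  | add x y hx hy => exact add_mem hx hy
  | single b p =>
    induction p using MvPolynomial.induction_on' with
    | add p q hp hq => rw [Finsupp.single_add]; exact add_mem hp hq
    | monomial c a =>
      have h : (Finsupp.single b (monomial c a) : ι →₀ MvPolynomial σ K) ∈
          homogPart degι {c.degree + degι b} := by
        convert (isGradingFamily_homogPart degι).smul_mem c a _ _ (single_one_mem_homogPart degι b)
        rw [Finsupp.smul_single, smul_eq_mul, mul_one]
      have hmono := (isGradingFamily_homogPart (σ := σ) (K := K) degι).mono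
      by_cases hP : c.degree + degι b ∈ P
      · exact AddSubgroup.mem_sup_left (hmono (Set.singleton_subset_iff.2 hP) h)
      · exact AddSubgroup.mem_sup_right (hmono (Set.singleton_subset_iff.2 hP) h)

theorem IsGradingFamily.exists_homogeneous_preimage (hY : IsGradingFamily σ K Y)
    {g : (κ →₀ MvPolynomial σ K) →ₗ[MvPolynomial σ K] M}
    (hg : ∀ b, g (Finsupp.single b 1) ∈ Y {degκ b}) {j : ℕ} {y : M} (hy : y ∈ Y {j})
    (hyg : y ∈ LinearMap.range g) : ∃ x ∈ homogPart degκ {j}, g x = y := by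
  obtain ⟨x, rfl⟩ := hyg
  obtain ⟨x₁, h₁, x₂, h₂, rfl⟩ := exists_add_of_homogPart degκ {j} x
  refine ⟨x₁, h₁, ?_⟩
  have h0 : g x₂ = 0 := by
    refine hY.eq_zero j _ ?_ (hY.map_mem hg h₂)
    have := sub_mem hy (hY.map_mem hg h₁)
    rwa [map_add, add_sub_cancel_left] at this
  rw [map_add, h0, add_zero]

theorem IsGradingFamily.exists_lift (hY : IsGradingFamily σ K Y)
    {f : (ι →₀ MvPolynomial σ K) →ₗ[MvPolynomial σ K] M}
    {g : (κ →₀ MvPolynomial σ K) →ₗ[MvPolynomial σ K] M}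
    (hf : ∀ b, f (Finsupp.single b 1) ∈ Y {degι b}) (hg : ∀ b, g (Finsupp.single b 1) ∈ Y {degκ b})
    (hfg : LinearMap.range f ≤ LinearMap.range g) :
    ∃ h : (ι →₀ MvPolynomial σ K) →ₗ[MvPolynomial σ K] (κ →₀ MvPolynomial σ K),
      (∀ b, h (Finsupp.single b 1) ∈ homogPart degκ {degι b}) ∧ g ∘ₗ h = f := by
  choose x hx hgx using fun b => hY.exists_homogeneous_preimage hg (hf b)
    (hfg (LinearMap.mem_range_self f _))
  refine ⟨Finsupp.linearCombination _ x, fun b => ?_, Finsupp.lhom_ext' fun b => ?_⟩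
  · rw [Finsupp.linearCombination_single, one_smul]
    exact hx b
  · ext
    simp [hgx]

/-- An endomorphism of a graded free module which is the identity modulo the irrelevant ideal is
bijective. -/
theorem bijective_of_constantCoeff_sub
    {χ : (ι →₀ MvPolynomial σ K) →ₗ[MvPolynomial σ K] (ι →₀ MvPolynomial σ K)}
    (hχ : ∀ b, χ (Finsupp.single b 1) ∈ homogPart degι {degι b})
    (hc : ∀ b b', constantCoeff ((χ (Finsupp.single b 1) - Finsupp.single b 1 : ι →₀ MvPolynomial σ K) b') = 0) :
    Function.Bijective χ := by
  have hlt : ∀ b b', (χ (Finsupp.single b 1) - Finsupp.single b 1 : ι →₀ MvPolynomial σ K) b' ≠ 0 → degι b' < degι b := by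
    intro b b' h
    obtain ⟨c, hc'⟩ := ne_zero_iff.1 h
    have h1 := sub_mem (hχ b) (single_one_mem_homogPart degι b) b' c hc'
    have h2 : c.degree ≠ 0 := by
      rw [Ne, Finsupp.degree_eq_zero_iff]
      rintro rfl
      exact hc' (hc b b')
    rw [Set.mem_singleton_iff] at h1
    omega
  have hsum : ∀ x, χ x = x + x.sum fun b p => p • (χ (Finsupp.single b 1) - Finsupp.single b 1) := by
    intro x
    induction x using Finsupp.induction_linear with
    | zero => simp
    | add x y hx hy =>
      rw [Finsupp.sum_add_index' (by simp) (by intros; rw [add_smul]), map_add, hx, hy]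
      abel
    | single b p =>
      rw [Finsupp.sum_single_index (by simp), smul_sub, ← map_smul, Finsupp.smul_single, smul_eq_mul,
        mul_one, add_sub_cancel]
  constructor
  · rw [injective_iff_map_eq_zero]
    intro x hx
    by_contra h0
    obtain ⟨b, hb, hmax⟩ := x.support.exists_max_image degι (Finsupp.support_nonempty_iff.2 h0)
    rw [hsum] at hx
    have := DFunLike.congr_fun hx b
    rw [Finsupp.add_apply, Finsupp.sum_apply, Finsupp.sum, Finset.sum_eq_zero, add_zero] at this
    · exact Finsupp.mem_support_iff.1 hb this
    · intro b' hb'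
      rw [Finsupp.smul_apply, smul_eq_mul]
      by_contra h
      exact absurd (hlt b' b (right_ne_zero_of_mul h)) (not_lt.2 (hmax b' hb'))
  · have hmem : ∀ j b, degι b = j → Finsupp.single b 1 ∈ LinearMap.range χ := by
      intro j
      induction j using Nat.strong_induction_on with
      | _ j ih =>
        intro b hb
        set v := χ (Finsupp.single b 1) - Finsupp.single b 1 with hv
        have hvmem : v ∈ LinearMap.range χ := by
          rw [← Finsupp.sum_single v]
          refine sum_mem fun b' hb' => ?_
          have := Submodule.smul_mem _ (v b') (ih (degι b')
            (hb ▸ hlt b b' (Finsupp.mem_support_iff.1 hb')) b' rfl)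
          rwa [Finsupp.smul_single, smul_eq_mul, mul_one] at this
        have := sub_mem (LinearMap.mem_range_self χ (Finsupp.single b 1)) hvmem
        rwa [hv, sub_sub_cancel] at this
    intro x
    change x ∈ LinearMap.range χ
    rw [← Finsupp.sum_single x]
    refine sum_mem fun b _ => ?_
    have := Submodule.smul_mem _ (x b) (hmem _ b rfl)
    rwa [Finsupp.smul_single, smul_eq_mul, mul_one] at this

/-- Two minimal graded free covers of the same graded module are isomorphic. -/
theorem IsGradingFamily.exists_inverse_lifts (hY : IsGradingFamily σ K Y)
    {f : (ι →₀ MvPolynomial σ K) →ₗ[MvPolynomial σ K] M}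
    {g : (κ →₀ MvPolynomial σ K) →ₗ[MvPolynomial σ K] M}
    (hf : ∀ b, f (Finsupp.single b 1) ∈ Y {degι b}) (hg : ∀ b, g (Finsupp.single b 1) ∈ Y {degκ b})
    (hfg : LinearMap.range f = LinearMap.range g)
    (hf0 : ∀ x, f x = 0 → ∀ b, constantCoeff (x b) = 0)
    (hg0 : ∀ x, g x = 0 → ∀ b, constantCoeff (x b) = 0) :
    ∃ (φ : (ι →₀ MvPolynomial σ K) →ₗ[MvPolynomial σ K] (κ →₀ MvPolynomial σ K))
      (ψ : (κ →₀ MvPolynomial σ K) →ₗ[MvPolynomial σ K] (ι →₀ MvPolynomial σ K)),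
      (∀ b, φ (Finsupp.single b 1) ∈ homogPart degκ {degι b}) ∧
      (∀ b, ψ (Finsupp.single b 1) ∈ homogPart degι {degκ b}) ∧
      (∀ x, ψ (φ x) = x) ∧ (∀ x, φ (ψ x) = x) ∧ g ∘ₗ φ = f := by
  obtain ⟨φ, hφ, hgφ⟩ := hY.exists_lift hf hg hfg.le
  obtain ⟨ψ, hψ, hfψ⟩ := hY.exists_lift hg hf hfg.ge
  have h1 : Function.Bijective (ψ ∘ₗ φ) := by
    refine bijective_of_constantCoeff_sub
      (fun b => (isGradingFamily_homogPart degι).map_mem hψ (hφ b)) fun b => hf0 _ ?_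
    rw [map_sub, ← LinearMap.comp_apply, ← LinearMap.comp_assoc, hfψ, hgφ, sub_self]
  have h2 : Function.Bijective (φ ∘ₗ ψ) := by
    refine bijective_of_constantCoeff_sub
      (fun b => (isGradingFamily_homogPart degκ).map_mem hφ (hψ b)) fun b => hg0 _ ?_
    rw [map_sub, ← LinearMap.comp_apply, ← LinearMap.comp_assoc, hgφ, hfψ, sub_self]
  obtain ⟨θ, hθ, hφθ⟩ := (isGradingFamily_homogPart degκ).exists_lift
    (single_one_mem_homogPart degκ) hφ (f := LinearMap.id) (by
      rw [LinearMap.range_eq_top.2 (Function.Surjective.of_comp (f := φ) (g := ψ) h2.2)]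
      exact le_top)
  have hφθ' : ∀ x, φ (θ x) = x := fun x => LinearMap.congr_fun hφθ x
  exact ⟨φ, θ, hφ, hθ, fun x =>
    Function.Injective.of_comp (f := ψ) (g := φ) h1.1 (hφθ' (φ x)), hφθ', hgφ⟩

variable (I : Ideal (MvPolynomial σ K))

/-- The sum of the homogeneous components of `R ⧸ I` of degrees in `P`. -/
noncomputable def quotientPart (P : Set ℕ) : AddSubgroup (MvPolynomial σ K ⧸ I) :=
  (homogPart (σ := σ) (K := K) (fun _ : Unit => 0) P).map
    ((Ideal.Quotient.mk I).toAddMonoidHom.comp (Finsupp.applyAddHom ()))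

variable {I} in
theorem mem_quotientPart {P : Set ℕ} {y : MvPolynomial σ K ⧸ I} :
    y ∈ quotientPart I P ↔
      ∃ p : MvPolynomial σ K, (∀ c, coeff c p ≠ 0 → c.degree ∈ P) ∧ Ideal.Quotient.mk I p = y := by
  constructor
  · rintro ⟨x, hx, rfl⟩
    exact ⟨x (), fun c hc => hx () c hc, rfl⟩
  · rintro ⟨p, hp, rfl⟩
    refine ⟨Finsupp.single () p, fun b c hc => hp c ?_, ?_⟩
    · simpa using hc
    · simp

theorem isGradingFamily_quotientPart (hI : ∀ p ∈ I, ∀ j, homogeneousComponent j p ∈ I) :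
    IsGradingFamily σ K (quotientPart I) where
  mono _ _ h := AddSubgroup.map_mono ((isGradingFamily_homogPart _).mono h)
  smul_mem c a j y hy := by
    obtain ⟨x, hx, rfl⟩ := hy
    exact ⟨monomial c a • x, (isGradingFamily_homogPart _).smul_mem c a j x hx, rfl⟩
  eq_zero j y h1 h2 := by
    obtain ⟨p, hp, rfl⟩ := mem_quotientPart.1 h1
    obtain ⟨q, hq, hpq⟩ := mem_quotientPart.1 h2
    rw [Ideal.Quotient.eq_zero_iff_mem]
    have h := hI _ (Ideal.Quotient.eq.1 hpq) j
    convert neg_mem h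
    ext c
    rw [coeff_neg, coeff_homogeneousComponent, coeff_sub]
    split_ifs with hc
    · by_cases hq0 : coeff c q = 0
      · rw [hq0, zero_sub, neg_neg]
      · exact absurd hc (hq c hq0)
    · by_contra hp0
      exact hc (hp c fun h => hp0 (by rw [h, neg_zero]))

/-- A minimal graded free resolution of `R ⧸ I`, with arbitrary homogeneous bases. -/
structure IsMinimalResolution {ι : ℕ → Type*} (deg : ∀ i, ι i → ℕ)
    (d : ∀ i, (ι (i + 1) →₀ MvPolynomial σ K) →ₗ[MvPolynomial σ K] (ι i →₀ MvPolynomial σ K))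
    (ε : (ι 0 →₀ MvPolynomial σ K) →ₗ[MvPolynomial σ K] (MvPolynomial σ K ⧸ I)) : Prop where
  surjective : Function.Surjective ε
  ker_augmentation : LinearMap.ker ε = LinearMap.range (d 0)
  ker_differential : ∀ i, LinearMap.ker (d i) = LinearMap.range (d (i + 1))
  differential_mem : ∀ i b, d i (Finsupp.single b 1) ∈ homogPart (deg i) {deg (i + 1) b}
  constantCoeff_eq_zero : ∀ i b b', constantCoeff ((d i (Finsupp.single b 1)) b') = 0
  augmentation_mem : ∀ b, ε (Finsupp.single b 1) ∈ quotientPart I {deg 0 b}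

theorem constantCoeff_apply_eq_zero
    {f : (ι →₀ MvPolynomial σ K) →ₗ[MvPolynomial σ K] (κ →₀ MvPolynomial σ K)}
    (hf : ∀ b b', constantCoeff ((f (Finsupp.single b 1)) b') = 0) (x : ι →₀ MvPolynomial σ K)
    (b' : κ) : constantCoeff ((f x) b') = 0 := by
  induction x using Finsupp.induction_linear with
  | zero => rw [map_zero, Finsupp.zero_apply, map_zero]
  | add x y hx hy => rw [map_add, Finsupp.add_apply, map_add, hx, hy, add_zero]
  | single b p =>
    have : f (Finsupp.single b p) = p • f (Finsupp.single b 1) := by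
      rw [← map_smul, Finsupp.smul_single, smul_eq_mul, mul_one]
    rw [this, Finsupp.smul_apply, smul_eq_mul, map_mul, hf, mul_zero]

theorem card_fiber_le_of_leftInverse
    {φ : (ι →₀ MvPolynomial σ K) →ₗ[MvPolynomial σ K] (κ →₀ MvPolynomial σ K)}
    {ψ : (κ →₀ MvPolynomial σ K) →ₗ[MvPolynomial σ K] (ι →₀ MvPolynomial σ K)}
    (hφ : ∀ b, φ (Finsupp.single b 1) ∈ homogPart degκ {degι b}) (h : ∀ x, ψ (φ x) = x) (j : ℕ)
    [Finite {b // degι b = j}] [Finite {b // degκ b = j}] :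
    Nat.card {b // degι b = j} ≤ Nat.card {b // degκ b = j} := by
  classical
  have := Fintype.ofFinite {b // degι b = j}
  have := Fintype.ofFinite {b // degκ b = j}
  let A : Matrix {b // degι b = j} {b // degκ b = j} K := fun b b' =>
    constantCoeff (φ (Finsupp.single b.1 1) b'.1)
  let B : Matrix {b // degκ b = j} {b // degι b = j} K := fun b' b =>
    constantCoeff (ψ (Finsupp.single b'.1 1) b.1)
  have hAB : A * B = 1 := by
    ext b b''
    have h1 : ψ (φ (Finsupp.single b.1 1)) b''.1 = (φ (Finsupp.single b.1 1)).sum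
        fun b' p => p * ψ (Finsupp.single b' 1) b''.1 := by
      conv_lhs => rw [← Finsupp.sum_single (φ (Finsupp.single b.1 1))]
      rw [map_finsuppSum, Finsupp.sum_apply]
      refine Finsupp.sum_congr fun b' _ => ?_
      rw [← smul_eq_mul, ← Finsupp.smul_apply, ← map_smul, Finsupp.smul_single, smul_eq_mul,
        mul_one]
    rw [h, Finsupp.single_apply] at h1
    have h2 := congr_arg constantCoeff h1
    rw [Finsupp.sum, map_sum] at h2
    rw [Matrix.mul_apply, Matrix.one_apply]
    trans constantCoeff (if b.1 = b''.1 then (1 : MvPolynomial σ K) else 0)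
    · rw [h2]
      refine Eq.trans ?_ (Finset.sum_congr_of_eq_on_inter
        (s₁ := Finset.univ.map (Function.Embedding.subtype fun b => degκ b = j))
        (f := fun b' => constantCoeff (φ (Finsupp.single b.1 1) b') *
          constantCoeff (ψ (Finsupp.single b' 1) b''.1)) ?_ ?_ ?_)
      · rw [Finset.sum_map]
        rfl
      · intro b' _ hb'
        rw [Finsupp.notMem_support_iff.1 hb', map_zero, zero_mul]
      · intro b' _ hb'
        rw [map_mul]
        by_contra h0
        have := hφ b.1 b' 0 (left_ne_zero_of_mul h0)
        simp only [Finset.mem_map, Finset.mem_univ, true_and, Function.Embedding.subtype_apply,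
          Subtype.exists, exists_prop, exists_eq_right] at hb'
        rw [map_zero, zero_add, Set.mem_singleton_iff, b.2] at this
        exact hb' this
      · intro b' _ _
        rw [map_mul]
    · simp only [Subtype.ext_iff]
      split_ifs <;> simp
  rw [Nat.card_eq_fintype_card, Nat.card_eq_fintype_card,
    ← Matrix.rank_one (R := K) (n := {b // degι b = j}), ← hAB]
  exact (Matrix.rank_mul_le_left A B).trans (Matrix.rank_le_card_width A)

theorem map_ker_eq_ker {R M₁ M₂ M₃ : Type*} [Ring R] [AddCommGroup M₁] [AddCommGroup M₂]
    [AddCommGroup M₃] [Module R M₁] [Module R M₂] [Module R M₃] {f : M₁ →ₗ[R] M₃} {g : M₂ →ₗ[R] M₃}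
    {φ : M₁ →ₗ[R] M₂} {ψ : M₂ →ₗ[R] M₁} (hφψ : ∀ x, φ (ψ x) = x) (hgφ : g ∘ₗ φ = f) :
    (LinearMap.ker f).map φ = LinearMap.ker g := by
  ext y
  constructor
  · rintro ⟨x, hx, rfl⟩
    rw [← hgφ] at hx
    exact hx
  · intro hy
    refine ⟨ψ y, ?_, hφψ y⟩
    rw [← hgφ]
    change g (φ (ψ y)) = 0
    rw [hφψ]
    exact hy

variable {I} in
/-- The graded Betti numbers do not depend on the choice of the minimal resolution. -/
theorem IsMinimalResolution.card_fiber_eq (hI : ∀ p ∈ I, ∀ j, homogeneousComponent j p ∈ I)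
    {ι κ : ℕ → Type*} {deg : ∀ i, ι i → ℕ} {deg' : ∀ i, κ i → ℕ}
    {d : ∀ i, (ι (i + 1) →₀ MvPolynomial σ K) →ₗ[MvPolynomial σ K] (ι i →₀ MvPolynomial σ K)}
    {ε : (ι 0 →₀ MvPolynomial σ K) →ₗ[MvPolynomial σ K] (MvPolynomial σ K ⧸ I)}
    {d' : ∀ i, (κ (i + 1) →₀ MvPolynomial σ K) →ₗ[MvPolynomial σ K] (κ i →₀ MvPolynomial σ K)}
    {ε' : (κ 0 →₀ MvPolynomial σ K) →ₗ[MvPolynomial σ K] (MvPolynomial σ K ⧸ I)}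
    (h : IsMinimalResolution I deg d ε) (h' : IsMinimalResolution I deg' d' ε')
    (hfin : ∀ i j, Finite {b // deg i b = j}) (hfin' : ∀ i j, Finite {b // deg' i b = j})
    (i j : ℕ) : Nat.card {b // deg i b = j} = Nat.card {b // deg' i b = j} := by
  suffices H : ∃ (φ : (ι i →₀ MvPolynomial σ K) →ₗ[MvPolynomial σ K] (κ i →₀ MvPolynomial σ K))
      (ψ : (κ i →₀ MvPolynomial σ K) →ₗ[MvPolynomial σ K] (ι i →₀ MvPolynomial σ K)),
      (∀ b, φ (Finsupp.single b 1) ∈ homogPart (deg' i) {deg i b}) ∧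
      (∀ b, ψ (Finsupp.single b 1) ∈ homogPart (deg i) {deg' i b}) ∧
      (∀ x, ψ (φ x) = x) ∧ (∀ x, φ (ψ x) = x) ∧
      (LinearMap.range (d i)).map φ = LinearMap.range (d' i) by
    obtain ⟨φ, ψ, hφ, hψ, hψφ, hφψ, _⟩ := H
    have := hfin i j
    have := hfin' i j
    exact le_antisymm (card_fiber_le_of_leftInverse hφ hψφ j)
      (card_fiber_le_of_leftInverse hψ hφψ j)
  have hker : ∀ i x, x ∈ LinearMap.range (d i) → ∀ b, constantCoeff (x b) = 0 := by
    rintro i _ ⟨x, rfl⟩ b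
    exact constantCoeff_apply_eq_zero (h.constantCoeff_eq_zero i) x b
  have hker' : ∀ i x, x ∈ LinearMap.range (d' i) → ∀ b, constantCoeff (x b) = 0 := by
    rintro i _ ⟨x, rfl⟩ b
    exact constantCoeff_apply_eq_zero (h'.constantCoeff_eq_zero i) x b
  induction i with
  | zero =>
    obtain ⟨φ, ψ, hφ, hψ, hψφ, hφψ, hg⟩ := (isGradingFamily_quotientPart I hI).exists_inverse_lifts
      h.augmentation_mem h'.augmentation_mem
      ((LinearMap.range_eq_top.2 h.surjective).trans (LinearMap.range_eq_top.2 h'.surjective).symm)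
      (fun x hx => hker 0 x (h.ker_augmentation ▸ hx))
      (fun x hx => hker' 0 x (h'.ker_augmentation ▸ hx))
    refine ⟨φ, ψ, hφ, hψ, hψφ, hφψ, ?_⟩
    rw [← h.ker_augmentation, ← h'.ker_augmentation]
    exact map_ker_eq_ker hφψ hg
  | succ i ih =>
    obtain ⟨φ₀, ψ₀, hφ₀, hψ₀, hψφ₀, hφψ₀, hr⟩ := ih
    have hk : LinearMap.ker (φ₀ ∘ₗ d i) = LinearMap.ker (d i) :=
      LinearMap.ker_comp_of_ker_eq_bot _ (LinearMap.ker_eq_bot.2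
        (Function.LeftInverse.injective hψφ₀))
    obtain ⟨φ, ψ, hφ, hψ, hψφ, hφψ, hg⟩ :=
      (isGradingFamily_homogPart (deg' i)).exists_inverse_lifts (f := φ₀ ∘ₗ d i)
      (fun b => (isGradingFamily_homogPart _).map_mem hφ₀ (h.differential_mem i b))
      (h'.differential_mem i) ((LinearMap.range_comp _ _).trans hr)
      (fun x hx => hker (i + 1) x (h.ker_differential i ▸ hk ▸ hx))
      (fun x hx => hker' (i + 1) x (h'.ker_differential i ▸ hx))
    refine ⟨φ, ψ, hφ, hψ, hψφ, hφψ, ?_⟩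
    rw [← h.ker_differential, ← h'.ker_differential, ← hk]
    exact map_ker_eq_ker hφψ hg

end Uniqueness

section Betti

variable {K : Type*} [Field K] {n : ℕ} {I : Ideal (MvPolynomial (Fin n) K)} {β : ℕ → ℕ → ℕ}

theorem IsMinimalFreeResolution.exists_isMinimalResolution (h : IsMinimalFreeResolution K I β) :
    ∃ d ε, IsMinimalResolution I (fun i (b : bettiBasis β i) => b.1.1) d ε := by
  obtain ⟨d, ε, h1, h2, h3, h4, h5, h6⟩ := h
  refine ⟨d, ε, h1, h2, h3, fun i b b' c hc => ?_, h5, fun b => ?_⟩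
  · rcases h4 i b b' with h0 | ⟨hle, hh⟩
    · rw [h0, coeff_zero] at hc
      exact absurd rfl hc
    · have := not_not.1 (mt (hh.coeff_eq_zero (d := c)) hc)
      rw [Set.mem_singleton_iff, this]
      exact Nat.sub_add_cancel hle
  · obtain ⟨p, hp, hpb⟩ := h6 b
    exact mem_quotientPart.2 ⟨p, fun c hc => not_not.1 (mt
      (IsHomogeneous.coeff_eq_zero (d := c) ((mem_homogeneousSubmodule _ _).1 hp)) hc), hpb⟩

/-- The basis elements of internal degree `j`. -/
def bettiBasisFiberEquiv (β : ℕ → ℕ → ℕ) (i j : ℕ) :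
    {b : bettiBasis β i // b.1.1 = j} ≃ Fin (β i j) where
  toFun b := ⟨b.1.1.2, by
    have h := b.1.2
    rwa [b.2] at h⟩
  invFun t := ⟨⟨(j, t), t.2⟩, rfl⟩
  left_inv b := by
    obtain ⟨⟨⟨j', t⟩, ht⟩, rfl⟩ := b
    rfl
  right_inv _ := rfl

theorem IsMinimalFreeResolution.betti_eq (hI : ∀ p ∈ I, ∀ j, homogeneousComponent j p ∈ I)
    (h : IsMinimalFreeResolution K I β) {κ : ℕ → Type*} {deg : ∀ i, κ i → ℕ}
    {d : ∀ i, (κ (i + 1) →₀ MvPolynomial (Fin n) K) →ₗ[MvPolynomial (Fin n) K]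
      (κ i →₀ MvPolynomial (Fin n) K)}
    {ε : (κ 0 →₀ MvPolynomial (Fin n) K) →ₗ[MvPolynomial (Fin n) K] (MvPolynomial (Fin n) K ⧸ I)}
    (h' : IsMinimalResolution I deg d ε) (hfin : ∀ i, Finite (κ i)) (i j : ℕ) :
    β i j = Nat.card {b // deg i b = j} := by
  obtain ⟨d₀, ε₀, h₀⟩ := h.exists_isMinimalResolution
  rw [← h₀.card_fiber_eq hI h' (fun i j => Finite.of_equiv _ (bettiBasisFiberEquiv β i j).symm)
    (fun i j => inferInstance), Nat.card_congr (bettiBasisFiberEquiv β i j),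
    Nat.card_eq_fintype_card, Fintype.card_fin]

theorem homogeneousComponent_mem_span {σ : Type*} {s : Set (MvPolynomial σ K)}
    (hs : ∀ f ∈ s, ∃ e, f.IsHomogeneous e) (p) (hp : p ∈ Ideal.span s) (j : ℕ) :
    homogeneousComponent j p ∈ Ideal.span s := by
  let _ : GradedRing (homogeneousSubmodule σ K) := gradedAlgebra
  have h := Ideal.homogeneous_span (homogeneousSubmodule σ K) s (fun f hf => hs f hf) j hp
  rwa [← decomposition.decompose'_apply]

theorem homogeneousComponent_mem_vanIdeal (k : ℕ) (p) (hp : p ∈ vanIdeal K n k) (j : ℕ) :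
    homogeneousComponent j p ∈ vanIdeal K n k := by
  refine homogeneousComponent_mem_span ?_ p hp j
  rintro _ ⟨g, rfl⟩
  refine ⟨∑ i : Fin (k + 1), (i : ℕ), ?_⟩
  rw [Matrix.det_apply]
  refine IsHomogeneous.sum _ _ _ fun τ _ => ?_
  rw [← Equiv.sum_comp τ]
  have h : (∏ i, (vandermondeMatrix K n k).submatrix id g (τ i) i).IsHomogeneous
      (∑ i, (τ i : ℕ)) :=
    IsHomogeneous.prod _ _ _ fun i _ => isHomogeneous_X_pow _ _
  rw [Units.smul_def, zsmul_eq_mul, ← map_intCast (C : K →+* MvPolynomial (Fin n) K)]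
  exact h.C_mul _

end Betti

/-! ### Wedge products of columns and minors -/

section Wedge

variable {S : Type*} [CommRing S]

/-- Left multiplication by the `s`-th column in the exterior algebra. -/
def extMul (s : ℕ) : ∀ m, (ColSet m → S) →ₗ[S] (ColSet m → S)
  | 0 => 0
  | m + 1 => if s = m then inclTake m ∘ₗ projSkip m else
      inclSkip m ∘ₗ extMul s m ∘ₗ projSkip m - inclTake m ∘ₗ extMul s m ∘ₗ projTake m

variable {m : ℕ}

theorem extMul_self (f : ColSet (m + 1) → S) : extMul m (m + 1) f = inclTake m (projSkip m f) := by
  rw [extMul, if_pos rfl, LinearMap.comp_apply]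

theorem extMul_succ {s : ℕ} (hs : s ≠ m) (f : ColSet (m + 1) → S) :
    extMul s (m + 1) f =
      inclSkip m (extMul s m (projSkip m f)) - inclTake m (extMul s m (projTake m f)) := by
  rw [extMul, if_neg hs]
  rfl

theorem extMul_inclSkip {s : ℕ} (hs : s < m) (f : ColSet m → S) :
    extMul s (m + 1) (inclSkip m f) = inclSkip m (extMul s m f) := by
  rw [extMul_succ hs.ne, projSkip_inclSkip, projTake_inclSkip, map_zero, map_zero, sub_zero]

theorem contr_extMul (c : ℕ → S) {s : ℕ} (hs : s < m) (f : ColSet m → S) :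
    contr c m (extMul s m f) = c s • f - extMul s m (contr c m f) := by
  induction m with
  | zero => omega
  | succ m ih =>
    by_cases h : s = m
    · subst h
      rw [extMul_self, extMul_self, contr_inclTake, projSkip_contr]
      conv_rhs => rw [← inclSkip_add_inclTake f]
      simp only [map_add, map_smul, smul_add, projSkip_inclSkip, projTake_inclSkip,
        projSkip_inclTake, projTake_inclTake, add_zero, zero_add]
      abel
    · rw [extMul_succ h, extMul_succ h, map_sub, contr_inclSkip, contr_inclTake, projSkip_contr,
        projTake_contr, ih (by omega), ih (by omega)]
      conv_rhs => rw [← inclSkip_add_inclTake f]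
      simp only [map_add, map_sub, map_neg, map_smul, smul_add, projSkip_inclSkip, projTake_inclSkip,
        projSkip_inclTake, projTake_inclTake, add_zero, zero_add]
      abel

theorem extMul_mem {s q : ℕ} {f : ColSet m → S} (hf : f ∈ extDeg S m q) :
    extMul s m f ∈ extDeg S m (q + 1) := by
  induction m generalizing q with
  | zero => exact zero_mem _
  | succ m ih =>
    by_cases h : s = m
    · subst h
      rw [extMul_self]
      exact inclTake_mem (projSkip_mem hf)
    · rw [extMul_succ h]
      refine sub_mem (inclSkip_mem (ih (projSkip_mem hf))) ?_
      cases q with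
      | zero =>
        have h0 : projTake m f = 0 := funext fun t => hf _ (by rw [ColSet.card_take]; omega)
        rw [h0, map_zero, map_zero]
        exact zero_mem _
      | succ q => exact inclTake_mem (ih (projTake_mem hf))

/-- The basis element of the exterior algebra given by the empty set of columns. -/
def extOne (S : Type*) [CommRing S] : ∀ m, ColSet m → S
  | 0 => fun _ => 1
  | m + 1 => inclSkip m (extOne S m)

theorem extOne_mem : ∀ m, extOne S m ∈ extDeg S m 0
  | 0 => fun | .nil, h => absurd rfl h
  | m + 1 => inclSkip_mem (extOne_mem m)

theorem extOne_empty : ∀ m, extOne S m (ColSet.empty m) = 1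
  | 0 => rfl
  | m + 1 => extOne_empty m

/-- The wedge product of a family of columns. -/
def wedge (S : Type*) [CommRing S] (m : ℕ) : ∀ {k : ℕ}, (Fin k → ℕ) → ColSet m → S
  | 0, _ => extOne S m
  | _ + 1, g => extMul (g 0) m (wedge S m fun j => g j.succ)

theorem wedge_succ {k : ℕ} (g : Fin (k + 1) → ℕ) :
    wedge S m g = extMul (g 0) m (wedge S m fun j => g j.succ) := rfl

theorem wedge_mem {k : ℕ} (g : Fin k → ℕ) : wedge S m g ∈ extDeg S m k := by
  induction k with
  | zero => exact extOne_mem m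
  | succ k ih => exact extMul_mem (ih _)

theorem inclSkip_wedge {k : ℕ} {g : Fin k → ℕ} (hg : ∀ j, g j < m) :
    inclSkip m (wedge S m g) = wedge S (m + 1) g := by
  induction k with
  | zero => rfl
  | succ k ih => rw [wedge_succ, wedge_succ, ← ih fun j => hg _, extMul_inclSkip (hg 0)]

theorem contr_wedge (c : ℕ → S) {k : ℕ} {g : Fin (k + 1) → ℕ} (hg : ∀ j, g j < m) :
    contr c m (wedge S m g) =
      ∑ j : Fin (k + 1), ((-1) ^ (j : ℕ) * c (g j)) • wedge S m fun i => g (j.succAbove i) := by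
  induction k with
  | zero =>
    rw [wedge_succ, contr_extMul c (hg 0), contr_eq_zero c (wedge_mem _), map_zero, sub_zero]
    simp [wedge]
  | succ k ih =>
    rw [wedge_succ, contr_extMul c (hg 0), ih fun j => hg _, map_sum, sub_eq_add_neg,
      ← Finset.sum_neg_distrib]
    conv_rhs => rw [Fin.sum_univ_succ]
    congr 1
    · simp
    · refine Finset.sum_congr rfl fun j _ => ?_
      rw [wedge_succ (fun i => g (j.succ.succAbove i)), map_smul, ← neg_smul]
      simp [pow_succ]

theorem detMap_wedge (y : ℕ → S) {k : ℕ} {g : Fin k → ℕ} (hg : ∀ j, g j < m) :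
    detMap (powContr y m) k (wedge S m g) =
      ((-1) ^ (∑ i ∈ Finset.range k, i) * (Matrix.of fun i j : Fin k => y (g j) ^ (i + 1 : ℕ)).det) •
        extOne S m := by
  induction k with
  | zero => simp [detMap, wedge]
  | succ k ih =>
    have hc : powContr y m (k + 1) (wedge S m g) = _ := contr_wedge _ hg
    rw [detMap_succ, hc, map_sum, Matrix.det_succ_row _ (Fin.last k),
      Finset.mul_sum, Finset.sum_smul]
    refine Finset.sum_congr rfl fun j _ => ?_
    rw [map_smul, ih fun i => hg _, smul_smul]
    congr 1
    have h1 : ((-1 : S) ^ k) * (-1) ^ k = 1 := by rw [← mul_pow]; simp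
    have h2 : (Matrix.of fun i j : Fin (k + 1) => y (g j) ^ (i + 1 : ℕ)).submatrix
        (Fin.last k).succAbove j.succAbove =
        Matrix.of fun i i' : Fin k => y (g (j.succAbove i')) ^ (i + 1 : ℕ) := by
      ext i i'
      simp
    rw [Finset.sum_range_succ, h2, Matrix.of_apply, Fin.val_last, pow_add, pow_add]
    linear_combination (-(-1) ^ (j : ℕ) * y (g j) ^ (k + 1) * (-1) ^ (∑ i ∈ Finset.range k, i) *
      (Matrix.of fun i i' : Fin k => y (g (j.succAbove i')) ^ (i + 1 : ℕ)).det) * h1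

open Classical in
theorem exists_wedge_eq_single {k : ℕ} (t : ColSet m) (ht : t.card = k) :
    ∃ g : Fin k → ℕ, (∀ j, g j < m) ∧ wedge S m g = Pi.single t 1 := by
  induction t generalizing k with
  | nil =>
    obtain rfl : k = 0 := ht.symm
    refine ⟨fun _ => 0, fun j => j.elim0, ?_⟩
    funext t'
    cases t'
    exact (Pi.single_eq_same (M := fun _ : ColSet 0 => S) _ _).symm
  | @skip m t ih =>
    obtain ⟨g, hg, h⟩ := ih ht
    refine ⟨g, fun j => (hg j).trans (Nat.lt_succ_self m), ?_⟩
    rw [← inclSkip_wedge hg, h]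
    funext t'
    cases t' with
    | skip t' => simp [inclSkip, Pi.single_apply]
    | take t' => simp [inclSkip]
  | @take m t ih =>
    obtain rfl : k = t.card + 1 := ht.symm
    obtain ⟨g, hg, h⟩ := ih rfl
    refine ⟨Fin.cons m g, fun j => ?_, ?_⟩
    · refine Fin.cases (Nat.lt_succ_self m) (fun j => (hg j).trans (Nat.lt_succ_self m)) j
    · change extMul m (m + 1) (wedge S (m + 1) g) = _
      rw [← inclSkip_wedge hg, h, extMul_self, projSkip_inclSkip]
      funext t'
      cases t' with
      | skip t' => simp [inclTake]
      | take t' => simp [inclTake, Pi.single_apply]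

end Wedge

section VandermondeIdeal

variable (K : Type*) [Field K]

/-- The difference of the variable with index `s + 1` and the variable with index `0`. -/
noncomputable def varDiff (m s : ℕ) : MvPolynomial (Fin (m + 1)) K :=
  if h : s < m then X (Fin.succ ⟨s, h⟩) - X 0 else 0

variable {K} {m k : ℕ}

theorem varDiff_fin (s : Fin m) : varDiff K m s = X s.succ - X 0 := dif_pos s.2

theorem vandermondeMatrix_minor (g : Fin (k + 1) → Fin (m + 1)) :
    ((vandermondeMatrix K (m + 1) k).submatrix id g).det =
      (Matrix.of fun i j : Fin (k + 1) =>
        (X (g j) - X 0 : MvPolynomial (Fin (m + 1)) K) ^ (i : ℕ)).det := by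
  have h := Matrix.det_vandermonde_sub (fun j => (X (g j) : MvPolynomial (Fin (m + 1)) K)) (X 0)
  rw [← Matrix.det_transpose, ← Matrix.det_transpose (Matrix.vandermonde fun j => X (g j))] at h
  exact h.symm

theorem det_varDiff_mem_vanIdeal (g : Fin k → Fin m) :
    (Matrix.of fun i j : Fin k => varDiff K m (g j) ^ (i + 1 : ℕ)).det ∈ vanIdeal K (m + 1) k := by
  by_cases hg : Function.Injective g
  · refine Ideal.subset_span ⟨⟨Fin.cons 0 fun j => (g j).succ, ?_⟩, ?_⟩
    · rw [Fin.cons_injective_iff]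
      refine ⟨?_, (Fin.succ_injective m).comp hg⟩
      rintro ⟨j, hj⟩
      exact Fin.succ_ne_zero _ hj
    · rw [vandermondeMatrix_minor, Matrix.det_succ_column_zero, Finset.sum_eq_single 0]
      · simp only [varDiff_fin]
        simp
        rfl
      · intro i _ hi
        simp [hi]
      · simp
  · obtain ⟨i, j, hij, hne⟩ : ∃ i j, g i = g j ∧ i ≠ j := by
      simpa [Function.Injective] using hg
    rw [Matrix.det_zero_of_column_eq hne]
    · exact zero_mem _
    · intro i'
      simp [hij]

variable (K m k) in
/-- The augmentation of the Eagon–Northcott complex. -/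
noncomputable def minorMap : (ColSet m → MvPolynomial (Fin (m + 1)) K) →ₗ[MvPolynomial (Fin (m + 1)) K]
    MvPolynomial (Fin (m + 1)) K :=
  LinearMap.proj (ColSet.empty m) ∘ₗ detMap (powContr (varDiff K m) m) k

theorem minorMap_wedge (g : Fin k → Fin m) :
    minorMap K m k (wedge _ m fun j => (g j : ℕ)) = (-1) ^ (∑ i ∈ Finset.range k, i) *
      (Matrix.of fun i j : Fin k => varDiff K m (g j) ^ (i + 1 : ℕ)).det := by
  have h := congr_fun (detMap_wedge (m := m) (varDiff K m) fun j => (g j).2) (ColSet.empty m)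
  rwa [Pi.smul_apply, extOne_empty, smul_eq_mul, mul_one] at h

theorem minorMap_mem_vanIdeal {u : ColSet m → MvPolynomial (Fin (m + 1)) K}
    (hu : u ∈ extDeg _ m k) : minorMap K m k u ∈ vanIdeal K (m + 1) k := by
  classical
  have := Fintype.ofFinite (ColSet m)
  rw [pi_eq_sum_univ' u, map_sum]
  refine sum_mem fun t _ => ?_
  rw [map_smul, smul_eq_mul]
  by_cases ht : t.card = k
  · subst ht
    obtain ⟨g, hg, h⟩ := exists_wedge_eq_single (S := MvPolynomial (Fin (m + 1)) K) t rfl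
    rw [show Pi.single t 1 = wedge (MvPolynomial (Fin (m + 1)) K) m fun j =>
        ((⟨g j, hg j⟩ : Fin m) : ℕ) from h.symm,
      minorMap_wedge fun j => ⟨g j, hg j⟩]
    exact Ideal.mul_mem_left _ _ (Ideal.mul_mem_left _ _ (det_varDiff_mem_vanIdeal _))
  · rw [hu t ht, zero_mul]
    exact zero_mem _

theorem det_sub_pow_mem_map_minorMap (g : Fin k → Fin (m + 1)) :
    (Matrix.of fun i j : Fin k => (X (g j) - X 0 : MvPolynomial (Fin (m + 1)) K) ^ (i + 1 : ℕ)).det ∈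
      (extDeg _ m k).map (minorMap K m k) := by
  by_cases hg : ∃ j, g j = 0
  · obtain ⟨j, hj⟩ := hg
    rw [Matrix.det_eq_zero_of_column_eq_zero j fun i => by simp [hj]]
    exact zero_mem _
  · push Not at hg
    choose g' hg' using fun j => Fin.exists_succ_eq.2 (hg j)
    have h := minorMap_wedge (K := K) g'
    simp only [varDiff_fin, hg'] at h
    refine ⟨(-1) ^ (∑ i ∈ Finset.range k, i) • wedge _ m fun j => (g' j : ℕ),
      Submodule.smul_mem _ _ (wedge_mem _), ?_⟩
    rw [map_smul, h, smul_eq_mul, ← mul_assoc, ← mul_pow]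
    simp

theorem vanIdeal_eq_map_minorMap :
    vanIdeal K (m + 1) k = (extDeg _ m k).map (minorMap K m k) := by
  apply le_antisymm
  · refine Ideal.span_le.2 ?_
    rintro _ ⟨g, rfl⟩
    rw [vandermondeMatrix_minor, Matrix.det_succ_row_zero]
    refine sum_mem fun j _ => Ideal.mul_mem_left _ _ ?_
    exact det_sub_pow_mem_map_minorMap fun i => g (j.succAbove i)
  · rintro _ ⟨u, hu, rfl⟩
    exact minorMap_mem_vanIdeal hu

end VandermondeIdeal

/-! ### The Eagon–Northcott resolution -/

section Resolution

variable {K : Type*} [Field K] {m k : ℕ}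

theorem isFreeVariable_varDiff {s : ℕ} (hs : s < m) :
    IsFreeVariable (varDiff K m) s (varDiff K m s) := by
  let z : MvPolynomial (Fin m) K := X ⟨s, hs⟩
  let ψ : MvPolynomial (Fin (m + 1)) K ≃+* Polynomial (MvPolynomial (Fin m) K) :=
    ((renameEquiv K (Equiv.swap 0 (Fin.succ ⟨s, hs⟩))).toRingEquiv.trans
      (finSuccEquiv K m).toRingEquiv).trans (Polynomial.algEquivAevalXAddC z).toRingEquiv
  have hX : ∀ j, ψ (X j) = Polynomial.aeval (Polynomial.X + Polynomial.C z)
      (finSuccEquiv K m (X (Equiv.swap 0 (Fin.succ ⟨s, hs⟩) j))) := fun j => by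
    simp [ψ]
  have h0 : ψ (X 0) = Polynomial.C z := by
    rw [hX, Equiv.swap_apply_left, finSuccEquiv_X_succ, Polynomial.aeval_C]
    rfl
  refine isFreeVariable_of_ringEquiv ψ ?_ fun i hi => ⟨X ⟨i, hi.trans hs⟩ - z, ?_⟩
  · rw [varDiff, dif_pos hs, map_sub, h0, hX, Equiv.swap_apply_right, finSuccEquiv_X_zero,
      Polynomial.aeval_X, add_sub_cancel_right]
  · rw [varDiff, dif_pos (hi.trans hs), map_sub, h0, hX, Equiv.swap_apply_of_ne_of_ne,
      finSuccEquiv_X_succ, Polynomial.aeval_C, Polynomial.C_sub]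
    · rfl
    · exact Fin.succ_ne_zero _
    · simp [Fin.ext_iff, hi.ne]

theorem varDiff_isHomogeneous (s : ℕ) : (varDiff K m s).IsHomogeneous 1 := by
  rw [varDiff]
  split_ifs
  · exact (isHomogeneous_X _ _).sub (isHomogeneous_X _ _)
  · exact isHomogeneous_zero _ _ _

/-- The polynomials which become homogeneous of degree `w` when multiplied by a homogeneous
element of degree `e`. -/
def homogShift (σ K : Type*) [Field K] (e w : ℕ) : AddSubgroup (MvPolynomial σ K) where
  carrier := {p | ∀ c, coeff c p ≠ 0 → c.degree + e = w}
  add_mem' {p q} hp hq c h := by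
    by_contra h'
    refine h ?_
    rw [coeff_add, not_not.1 fun h => h' (hp c h), not_not.1 fun h => h' (hq c h), add_zero]
  zero_mem' c h := absurd (coeff_zero c) h
  neg_mem' {p} hp c h := hp c fun h' => h (by rw [coeff_neg, h', neg_zero])

theorem mul_mem_homogShift {σ : Type*} {e r w : ℕ} {p q : MvPolynomial σ K}
    (hq : q.IsHomogeneous r) (hp : p ∈ homogShift σ K (e + r) w) :
    q * p ∈ homogShift σ K e w := by
  classical
  intro c hc
  rw [coeff_mul] at hc
  obtain ⟨⟨a, b⟩, hab, h⟩ := Finset.exists_ne_zero_of_sum_ne_zero hc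
  have h1 : a.degree = r := by
    by_contra h'
    exact left_ne_zero_of_mul h (hq.coeff_eq_zero h')
  have h2 := hp b (right_ne_zero_of_mul h)
  rw [← Finset.HasAntidiagonal.mem_antidiagonal.1 hab, map_add, ← h2, ← h1]
  ring

section Homogeneous

variable {σ : Type*} {y : ℕ → MvPolynomial σ K}

theorem contr_mem_homogShift {c : ℕ → MvPolynomial σ K} {r e w : ℕ}
    (hc : ∀ s, (c s).IsHomogeneous r) {u : ColSet m → MvPolynomial σ K}
    (hu : ∀ t, u t ∈ homogShift σ K (e + r) w) (t : ColSet m) :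
    contr c m u t ∈ homogShift σ K e w := by
  induction m with
  | zero => exact zero_mem _
  | succ m ih =>
    cases t with
    | skip t => exact add_mem (ih (fun t => hu (.skip t)) t) (mul_mem_homogShift (hc m) (hu _))
    | take t => exact neg_mem (ih (fun t => hu (.take t)) t)

variable (hy : ∀ s, (y s).IsHomogeneous 1)

include hy

theorem powContr_mem_homogShift {r e w : ℕ} {u : ColSet m → MvPolynomial σ K}
    (hu : ∀ t, u t ∈ homogShift σ K (e + r) w) (t : ColSet m) :
    powContr y m r u t ∈ homogShift σ K e w :=
  contr_mem_homogShift (fun s => by simpa using (hy s).pow r) hu t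

theorem rowDiff_mem_homogShift {e w : ℕ} {f : RowExp k → ColSet m → MvPolynomial σ K}
    (hf : ∀ a t, f a t ∈ homogShift σ K (e + a.weight) w) (a : RowExp k) (t : ColSet m) :
    rowDiff (powContr y m) k f a t ∈ homogShift σ K (e + a.weight) w := by
  induction k generalizing e with
  | zero => exact zero_mem _
  | succ k ih =>
    obtain _ | ⟨a, b⟩ := a
    rw [rowDiff_succ, Pi.add_apply]
    refine add_mem ?_ (powContr_mem_homogShift hy (fun t => ?_) t)
    · have he : e + (a.snoc b).weight = e + (k + 1) * b + a.weight := by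
        rw [RowExp.weight]; omega
      rw [he]
      refine ih (fun a t => ?_) a
      have := hf (a.snoc b) t
      rwa [RowExp.weight, show e + (a.weight + (k + 1) * b) = e + (k + 1) * b + a.weight by
        omega] at this
    · have := hf (a.snoc (b + 1)) t
      rwa [RowExp.weight, mul_add, mul_one, ← add_assoc, ← add_assoc, add_assoc e] at this

theorem detMap_mem_homogShift {e w : ℕ} {u : ColSet m → MvPolynomial σ K}
    (hu : ∀ t, u t ∈ homogShift σ K (e + ∑ i ∈ Finset.range (k + 1), i) w) (t : ColSet m) :
    detMap (powContr y m) k u t ∈ homogShift σ K e w := by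
  induction k generalizing u with
  | zero => exact (by simpa using hu t : u t ∈ homogShift σ K e w)
  | succ k ih =>
    refine ih fun t => powContr_mem_homogShift hy (fun t => ?_) t
    have := hu t
    rwa [Finset.sum_range_succ, ← add_assoc] at this

end Homogeneous

theorem constantCoeff_powContr_succ (r : ℕ) (u : ColSet m → MvPolynomial (Fin (m + 1)) K) (t) :
    constantCoeff (powContr (varDiff K m) m (r + 1) u t) = 0 := by
  have hc : ∀ s, constantCoeff (varDiff K m s ^ (r + 1)) = 0 := fun s => by
    rw [map_pow, constantCoeff_eq, (varDiff_isHomogeneous s).coeff_eq_zero (by simp), zero_pow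
      (Nat.succ_ne_zero r)]
  have h : ∀ m' (u : ColSet m' → MvPolynomial (Fin (m + 1)) K) t,
      constantCoeff (contr (fun s => varDiff K m s ^ (r + 1)) m' u t) = 0 := by
    intro m'
    induction m' with
    | zero => exact fun _ _ => map_zero _
    | succ m' ih =>
      intro u t
      cases t with
      | skip t =>
        change constantCoeff (contr _ m' (fun t => u (.skip t)) t +
          varDiff K m m' ^ (r + 1) * u (.take t)) = 0
        rw [map_add, ih, map_mul, hc, zero_mul, add_zero]
      | take t =>
        change constantCoeff (-contr _ m' (fun t => u (.take t)) t) = 0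
        rw [map_neg, ih, neg_zero]
  exact h m u t

theorem constantCoeff_rowDiff (f : RowExp k → ColSet m → MvPolynomial (Fin (m + 1)) K) (a t) :
    constantCoeff (rowDiff (powContr (varDiff K m) m) k f a t) = 0 := by
  induction k with
  | zero => exact map_zero _
  | succ k ih =>
    obtain _ | ⟨a, b⟩ := a
    rw [rowDiff_succ, Pi.add_apply, map_add, ih, constantCoeff_powContr_succ, add_zero]

end Resolution

section Basis

/-- The basis of the `p`-th term of the Eagon–Northcott complex, not counting the augmentation. -/
abbrev CellBasis (m k p : ℕ) : Type :=
  {x : RowExp k × ColSet m // x.1.size = p ∧ x.2.card = k + p}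

instance (m k p : ℕ) : Finite (CellBasis m k p) :=
  Set.Finite.to_subtype (((RowExp.finite_size_le k p).prod (Set.toFinite Set.univ)).subset
    fun _ hx => ⟨hx.1.le, trivial⟩)

variable {S : Type*} [CommRing S] {m k p : ℕ}

open Classical in
/-- Extension by zero of a function on the basis. -/
noncomputable def extendCell (S : Type*) [CommRing S] (m k p : ℕ) :
    (CellBasis m k p →₀ S) →ₗ[S] (RowExp k → ColSet m → S) :=
  LinearMap.pi fun a => LinearMap.pi fun t =>
    if h : a.size = p ∧ t.card = k + p then Finsupp.lapply ⟨(a, t), h⟩ else 0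

/-- Restriction of a function to the basis. -/
noncomputable def restrictCell (S : Type*) [CommRing S] (m k p : ℕ) :
    (RowExp k → ColSet m → S) →ₗ[S] (CellBasis m k p →₀ S) :=
  (Finsupp.linearEquivFunOnFinite S S (CellBasis m k p)).symm.toLinearMap ∘ₗ
    LinearMap.pi fun b => LinearMap.proj b.1.2 ∘ₗ LinearMap.proj b.1.1

theorem restrictCell_apply (f : RowExp k → ColSet m → S) (b : CellBasis m k p) :
    restrictCell S m k p f b = f b.1.1 b.1.2 := rfl

theorem extendCell_apply (x : CellBasis m k p →₀ S) (b : CellBasis m k p) :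
    extendCell S m k p x b.1.1 b.1.2 = x b := by
  simp [extendCell, b.2.1, b.2.2]

theorem extendCell_apply_of_not (x : CellBasis m k p →₀ S) {a : RowExp k} {t : ColSet m}
    (h : ¬(a.size = p ∧ t.card = k + p)) : extendCell S m k p x a t = 0 := by
  simp only [extendCell, LinearMap.pi_apply, dif_neg h, LinearMap.zero_apply]

theorem restrictCell_extendCell (x : CellBasis m k p →₀ S) :
    restrictCell S m k p (extendCell S m k p x) = x :=
  Finsupp.ext fun b => extendCell_apply x b

theorem extendCell_mem (x : CellBasis m k p →₀ S) :
    extendCell S m k p x ∈ bihomog (extDeg S m) k (k + p) p := fun _ =>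
  ⟨fun _ ht => extendCell_apply_of_not x fun h => ht h.2,
    fun ha => funext fun _ => extendCell_apply_of_not x fun h => ha h.1⟩

theorem extendCell_restrictCell {f : RowExp k → ColSet m → S}
    (hf : f ∈ bihomog (extDeg S m) k (k + p) p) :
    extendCell S m k p (restrictCell S m k p f) = f := by
  funext a t
  by_cases h : a.size = p ∧ t.card = k + p
  · exact extendCell_apply (restrictCell S m k p f) ⟨(a, t), h⟩
  · rw [extendCell_apply_of_not _ h]
    by_cases ha : a.size = p
    · exact ((hf a).1 t fun ht => h ⟨ha, ht⟩).symm
    · rw [(hf a).2 ha, Pi.zero_apply]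

end Basis

section Resolution

variable {K : Type*} [Field K] {m k : ℕ}

variable (K m k) in
/-- The differentials of the Eagon–Northcott complex. -/
noncomputable def cellDiff (p : ℕ) : (CellBasis m k (p + 1) →₀ MvPolynomial (Fin (m + 1)) K)
    →ₗ[MvPolynomial (Fin (m + 1)) K] (CellBasis m k p →₀ MvPolynomial (Fin (m + 1)) K) :=
  restrictCell _ m k p ∘ₗ rowDiff (powContr (varDiff K m) m) k ∘ₗ extendCell _ m k (p + 1)

variable (K m k) in
/-- The augmentation of the Eagon–Northcott complex. -/
noncomputable def cellAug : (CellBasis m k 0 →₀ MvPolynomial (Fin (m + 1)) K)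
    →ₗ[MvPolynomial (Fin (m + 1)) K] MvPolynomial (Fin (m + 1)) K :=
  minorMap K m k ∘ₗ LinearMap.proj (RowExp.zero k) ∘ₗ extendCell _ m k 0

theorem cellAug_apply (x : CellBasis m k 0 →₀ MvPolynomial (Fin (m + 1)) K) :
    cellAug K m k x = minorMap K m k (extendCell _ m k 0 x (RowExp.zero k)) := rfl

theorem extendCell_cellDiff {p : ℕ} (x : CellBasis m k (p + 1) →₀ MvPolynomial (Fin (m + 1)) K) :
    extendCell _ m k p (cellDiff K m k p x) =
      rowDiff (powContr (varDiff K m) m) k (extendCell _ m k (p + 1) x) :=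
  extendCell_restrictCell (rowDiff_mem powContr_mem (extendCell_mem x))

theorem cellDiff_restrictCell {p : ℕ} {f : RowExp k → ColSet m → MvPolynomial (Fin (m + 1)) K}
    (hf : f ∈ bihomog (extDeg _ m) k (k + (p + 1)) (p + 1)) :
    cellDiff K m k p (restrictCell _ m k (p + 1) f) =
      restrictCell _ m k p (rowDiff (powContr (varDiff K m) m) k f) := by
  rw [cellDiff, LinearMap.comp_apply, LinearMap.comp_apply, extendCell_restrictCell hf]

theorem isRowExact_varDiff :
    IsRowExact (powContr (varDiff K m) m) (extDeg (MvPolynomial (Fin (m + 1)) K) m) k :=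
  isRowExact_powContr (fun _ => isFreeVariable_varDiff) k

theorem detMap_eq_zero_of_minorMap_eq_zero {u : ColSet m → MvPolynomial (Fin (m + 1)) K}
    (hu : u ∈ extDeg _ m k) (h : minorMap K m k u = 0) :
    detMap (powContr (varDiff K m) m) k u = 0 := by
  have hd : detMap (powContr (varDiff K m) m) k u ∈ extDeg _ m 0 :=
    detMap_mem powContr_mem (by rwa [zero_add])
  funext t
  by_cases ht : t.card = 0
  · rw [ColSet.eq_empty_of_card_eq_zero t ht]
    exact h
  · exact hd t ht

theorem range_cellAug : LinearMap.range (cellAug K m k) = vanIdeal K (m + 1) k := by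
  rw [vanIdeal_eq_map_minorMap]
  apply le_antisymm
  · rintro _ ⟨x, rfl⟩
    exact ⟨_, (extendCell_mem x _).1, rfl⟩
  · rintro _ ⟨u, hu, rfl⟩
    classical
    have hf : (fun a => if a = RowExp.zero k then u else 0) ∈
        bihomog (extDeg (MvPolynomial (Fin (m + 1)) K) m) k (k + 0) 0 := by
      intro a
      dsimp only
      split_ifs with h
      · exact ⟨hu, fun h' => absurd (h ▸ RowExp.size_zero _) h'⟩
      · exact ⟨zero_mem _, fun _ => rfl⟩
    refine ⟨restrictCell _ m k 0 fun a => if a = RowExp.zero k then u else 0, ?_⟩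
    rw [cellAug_apply, extendCell_restrictCell hf]
    exact congr_arg _ (if_pos rfl)

theorem ker_cellAug : LinearMap.ker (cellAug K m k) = LinearMap.range (cellDiff K m k 0) := by
  ext x
  constructor
  · intro h
    rw [LinearMap.mem_ker, cellAug_apply] at h
    have hu := (extendCell_mem x (RowExp.zero k)).1
    obtain ⟨g, hg, hgu⟩ := isRowExact_varDiff.2 _ hu (detMap_eq_zero_of_minorMap_eq_zero hu h)
    refine ⟨restrictCell _ m k 1 g, (cellDiff_restrictCell hg).trans (Finsupp.ext fun b => ?_)⟩
    rw [← extendCell_apply x b, restrictCell_apply, RowExp.eq_zero_of_size_eq_zero _ b.2.1]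
    exact congr_fun hgu _
  · rintro ⟨x, rfl⟩
    rw [LinearMap.mem_ker, cellAug_apply, extendCell_cellDiff, minorMap, LinearMap.comp_apply,
      detMap_rowDiff powContr_comm powContr_self, map_zero]

theorem ker_cellDiff (p : ℕ) :
    LinearMap.ker (cellDiff K m k p) = LinearMap.range (cellDiff K m k (p + 1)) := by
  ext x
  constructor
  · intro h
    have h' := extendCell_cellDiff x
    rw [LinearMap.mem_ker.1 h, map_zero] at h'
    obtain ⟨g, hg, hgx⟩ := isRowExact_varDiff.1 p _ (extendCell_mem x) h'.symm
    refine ⟨restrictCell _ m k (p + 2) g, ?_⟩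
    rw [cellDiff_restrictCell hg, hgx, restrictCell_extendCell]
  · rintro ⟨x, rfl⟩
    rw [LinearMap.mem_ker, cellDiff, LinearMap.comp_apply, LinearMap.comp_apply,
      extendCell_cellDiff, rowDiff_rowDiff powContr_comm powContr_self, map_zero]

theorem extendCell_single_mem_homogShift {p : ℕ} (b : CellBasis m k p) (e : ℕ) (a : RowExp k)
    (t : ColSet m) :
    extendCell (MvPolynomial (Fin (m + 1)) K) m k p (Finsupp.single b 1) a t ∈
      homogShift _ K (e + a.weight) (e + b.1.1.weight) := by
  classical
  by_cases h : a.size = p ∧ t.card = k + p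
  · have h' := extendCell_apply (Finsupp.single b (1 : MvPolynomial (Fin (m + 1)) K)) ⟨(a, t), h⟩
    dsimp only at h'
    rw [h', Finsupp.single_apply]
    split_ifs with hb
    · intro c hc
      rw [coeff_one] at hc
      obtain rfl : 0 = c := by
        by_contra hne
        exact hc (if_neg hne)
      rw [map_zero, zero_add, hb]
    · exact zero_mem _
  · rw [extendCell_apply_of_not _ h]
    exact zero_mem _

theorem cellDiff_apply_mem {p : ℕ} (b : CellBasis m k (p + 1)) (b' : CellBasis m k p) (e : ℕ) :
    cellDiff K m k p (Finsupp.single b 1) b' ∈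
      homogShift _ K (e + b'.1.1.weight) (e + b.1.1.weight) :=
  rowDiff_mem_homogShift varDiff_isHomogeneous (extendCell_single_mem_homogShift b e) b'.1.1 b'.1.2

theorem cellAug_apply_mem (b : CellBasis m k 0) :
    cellAug K m k (Finsupp.single b 1) ∈ homogShift _ K 0 (∑ i ∈ Finset.range (k + 1), i) := by
  refine detMap_mem_homogShift varDiff_isHomogeneous (fun t => ?_) _
  have h := extendCell_single_mem_homogShift (K := K) b (∑ i ∈ Finset.range (k + 1), i)
    (RowExp.zero k) t
  rw [RowExp.eq_zero_of_size_eq_zero _ b.2.1, RowExp.weight_zero, add_zero] at h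
  rw [zero_add]
  exact h

/-- The basis of the terms of the Eagon–Northcott resolution. -/
def ResBasis (m k : ℕ) : ℕ → Type
  | 0 => Unit
  | p + 1 => CellBasis m k p

instance (m k : ℕ) : ∀ i, Finite (ResBasis m k i)
  | 0 => inferInstanceAs (Finite Unit)
  | p + 1 => inferInstanceAs (Finite (CellBasis m k p))

/-- The degrees of the basis elements in the Eagon–Northcott resolution. -/
def resDeg (m k : ℕ) : ∀ i, ResBasis m k i → ℕ
  | 0 => fun _ => 0
  | _ + 1 => fun b => ∑ i ∈ Finset.range (k + 1), i + b.1.1.weight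

variable (K m k) in
/-- The differentials of the Eagon–Northcott resolution. -/
noncomputable def resDiff : ∀ i, (ResBasis m k (i + 1) →₀ MvPolynomial (Fin (m + 1)) K)
    →ₗ[MvPolynomial (Fin (m + 1)) K] (ResBasis m k i →₀ MvPolynomial (Fin (m + 1)) K)
  | 0 => (Finsupp.lsingle () ∘ₗ cellAug K m k :
      (CellBasis m k 0 →₀ _) →ₗ[MvPolynomial (Fin (m + 1)) K] (Unit →₀ _))
  | p + 1 => cellDiff K m k p

variable (K m k) in
/-- The augmentation of the Eagon–Northcott resolution. -/
noncomputable def resAug : (Unit →₀ MvPolynomial (Fin (m + 1)) K)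
    →ₗ[MvPolynomial (Fin (m + 1)) K] (MvPolynomial (Fin (m + 1)) K ⧸ vanIdeal K (m + 1) k) :=
  (vanIdeal K (m + 1) k).mkQ ∘ₗ Finsupp.lapply ()

theorem ker_resAug :
    LinearMap.ker (resAug K m k) = LinearMap.range (Finsupp.lsingle () ∘ₗ cellAug K m k) := by
  rw [resAug, LinearMap.ker_comp, Submodule.ker_mkQ, ← range_cellAug, LinearMap.range_comp]
  ext x
  constructor
  · intro hx
    exact ⟨x (), hx, Finsupp.ext fun _ => Finsupp.single_eq_same⟩
  · rintro ⟨p, hp, rfl⟩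
    change Finsupp.single () p () ∈ LinearMap.range (cellAug K m k)
    rwa [Finsupp.single_eq_same]

theorem ker_lsingle_comp_cellAug :
    LinearMap.ker (Finsupp.lsingle () ∘ₗ cellAug K m k) = LinearMap.range (cellDiff K m k 0) := by
  rw [← ker_cellAug]
  exact LinearMap.ker_comp_of_ker_eq_bot _ (LinearMap.ker_eq_bot.2 (Finsupp.single_injective ()))

theorem lsingle_cellAug_mem (b : CellBasis m k 0) (u : Unit) :
    (Finsupp.lsingle () ∘ₗ cellAug K m k) (Finsupp.single b 1) u ∈
      homogShift _ K 0 (∑ i ∈ Finset.range (k + 1), i) := by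
  change Finsupp.single () _ () ∈ _
  rw [Finsupp.single_eq_same]
  exact cellAug_apply_mem b

theorem resAug_single_mem (u : Unit) :
    resAug K m k (Finsupp.single u 1) ∈ quotientPart (vanIdeal K (m + 1) k) {0} := by
  refine mem_quotientPart.2 ⟨1, fun c hc => ?_, ?_⟩
  · classical
    rw [coeff_one] at hc
    obtain rfl : 0 = c := by
      by_contra hne
      exact hc (if_neg hne)
    exact map_zero _
  · change _ = Ideal.Quotient.mk _ (Finsupp.single () 1 ())
    rw [Finsupp.single_eq_same]

theorem isMinimalResolution_resDiff (hk : k ≠ 0) :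
    IsMinimalResolution (vanIdeal K (m + 1) k) (resDeg m k) (resDiff K m k) (resAug K m k) where
  surjective := (Submodule.mkQ_surjective _).comp fun p =>
    ⟨Finsupp.single () p, Finsupp.single_eq_same⟩
  ker_augmentation := ker_resAug
  ker_differential
    | 0 => ker_lsingle_comp_cellAug
    | p + 1 => ker_cellDiff p
  differential_mem
    | 0, b => fun b' c hc => by
      have h := lsingle_cellAug_mem b b' c hc
      have hw : resDeg m k (0 + 1) b = ∑ i ∈ Finset.range (k + 1), i + b.1.1.weight := rfl
      rw [RowExp.eq_zero_of_size_eq_zero _ b.2.1, RowExp.weight_zero] at hw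
      rw [Set.mem_singleton_iff, hw]
      exact h
    | p + 1, b => fun b' c hc => cellDiff_apply_mem b b' _ c hc
  constantCoeff_eq_zero
    | 0, b, b' => by
      by_contra h
      have h := lsingle_cellAug_mem b b' 0 h
      rw [map_zero, zero_add] at h
      exact absurd (Finset.sum_eq_zero_iff.1 h.symm k (Finset.self_mem_range_succ k)) hk
    | p + 1, b, b' => constantCoeff_rowDiff _ _ _
  augmentation_mem := resAug_single_mem

end Resolution

/-! ### The recursion -/

section Count

/-- The basis elements of a term of the Eagon–Northcott complex, with internal degree `j` up to a
shift by `e`. -/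
abbrev CellFiber (m k p e j : ℕ) : Type :=
  {x : RowExp k × ColSet m // (x.1.size = p ∧ x.2.card = k + p) ∧
    ∑ i ∈ Finset.range (k + 1), i + x.1.weight + e = j}

instance (m k p e j : ℕ) : Finite (CellFiber m k p e j) :=
  Finite.of_injective (fun x => (⟨x.1, x.2.1⟩ : CellBasis m k p)) fun _ _ h =>
    Subtype.ext (congr_arg (fun y : CellBasis m k p => y.1) h)

theorem card_cellFiber_shift (m k p e j : ℕ) :
    Nat.card (CellFiber m k p e j) =
      if e ≤ j then Nat.card (CellFiber m k p 0 (j - e)) else 0 := by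
  split_ifs with h
  · refine Nat.card_congr (Equiv.subtypeEquivRight fun x => and_congr_right fun _ => ?_)
    omega
  · have : IsEmpty (CellFiber m k p e j) := ⟨fun x => h (by have := x.2.2; omega)⟩
    exact Nat.card_of_isEmpty

/-- Splitting according to whether the last column is used, and whether the last divided power
variable occurs. -/
def cellFiberEquiv (m k p j : ℕ) : CellFiber (m + 1) (k + 1) (p + 1) 0 j ≃
    (CellFiber m (k + 1) (p + 1) 0 j ⊕ CellFiber m k (p + 1) (k + 1) j) ⊕
      CellFiber m (k + 1) p (k + 1) j where
  toFun
    | ⟨(a, .skip t), h⟩ => .inl (.inl ⟨(a, t), h⟩)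
    | ⟨(.snoc a 0, .take t), h⟩ => .inl (.inr ⟨(a, t), by
        simp only [RowExp.size, RowExp.weight, ColSet.card,
          Finset.sum_range_succ _ (k + 1)] at h ⊢
        omega⟩)
    | ⟨(.snoc a (b + 1), .take t), h⟩ => .inr ⟨(.snoc a b, t), by
        simp only [RowExp.size, RowExp.weight, ColSet.card, mul_add] at h ⊢
        omega⟩
  invFun
    | .inl (.inl ⟨(a, t), h⟩) => ⟨(a, .skip t), h⟩
    | .inl (.inr ⟨(a, t), h⟩) => ⟨(.snoc a 0, .take t), by
        simp only [RowExp.size, RowExp.weight, ColSet.card,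
          Finset.sum_range_succ _ (k + 1)] at h ⊢
        omega⟩
    | .inr ⟨(.snoc a b, t), h⟩ => ⟨(.snoc a (b + 1), .take t), by
        simp only [RowExp.size, RowExp.weight, ColSet.card, mul_add] at h ⊢
        omega⟩
  left_inv
    | ⟨(.snoc _ _, .skip _), _⟩ => rfl
    | ⟨(.snoc _ 0, .take _), _⟩ => rfl
    | ⟨(.snoc _ (_ + 1), .take _), _⟩ => rfl
  right_inv
    | .inl (.inl ⟨(.snoc _ _, _), _⟩) => rfl
    | .inl (.inr ⟨(_, _), _⟩) => rfl
    | .inr ⟨(.snoc _ _, _), _⟩ => rfl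

theorem card_cellFiber_succ (m k p j : ℕ) :
    Nat.card (CellFiber (m + 1) (k + 1) (p + 1) 0 j) =
      (if k + 1 ≤ j then Nat.card (CellFiber m k (p + 1) 0 (j - (k + 1))) else 0) +
        Nat.card (CellFiber m (k + 1) (p + 1) 0 j) +
      (if k + 1 ≤ j then Nat.card (CellFiber m (k + 1) p 0 (j - (k + 1))) else 0) := by
  rw [Nat.card_congr (cellFiberEquiv m k p j), Nat.card_sum, Nat.card_sum,
    ← card_cellFiber_shift, ← card_cellFiber_shift]
  omega

end Count

theorem betti_vanIdeal_eq {K : Type*} [Field K] {m k : ℕ} (hk : k ≠ 0) {β : ℕ → ℕ → ℕ}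
    (h : IsMinimalFreeResolution K (vanIdeal K (m + 1) k) β) (p j : ℕ) :
    β (p + 1) j = Nat.card (CellFiber m k p 0 j) := by
  rw [h.betti_eq (homogeneousComponent_mem_vanIdeal k) (isMinimalResolution_resDiff hk)
    inferInstance]
  exact Nat.card_congr (Equiv.subtypeSubtypeEquivSubtypeInter
    (fun x : RowExp k × ColSet m => x.1.size = p ∧ x.2.card = k + p)
    fun x => ∑ i ∈ Finset.range (k + 1), i + x.1.weight = j)

/-- The recursion for the graded Betti numbers, for `i ≥ 2`:
`β_{i,j}(R/I_{n,k}) = β_{i,j-k}(R'/I_{n-1,k-1}) + β_{i,j}(R'/I_{n-1,k})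
  + β_{i-1,j-k}(R'/I_{n-1,k})`
for `n - 1 > k ≥ 2` (where terms with `j - k < 0` are `0`). -/
theorem vanIdeal_betti_recursion (K : Type*) [Field K] (n k : ℕ)
    (hk : 2 ≤ k) (hn : k < n - 1) (β β' β'' : ℕ → ℕ → ℕ)
    (hβ : IsMinimalFreeResolution K (vanIdeal K n k) β)
    (hβ' : IsMinimalFreeResolution K (vanIdeal K (n - 1) (k - 1)) β')
    (hβ'' : IsMinimalFreeResolution K (vanIdeal K (n - 1) k) β'')
    (i j : ℕ) (hi : 2 ≤ i) :
    β i j = (if k ≤ j then β' i (j - k) else 0) + β'' i j +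
      (if k ≤ j then β'' (i - 1) (j - k) else 0) := by
  obtain ⟨m, rfl⟩ : ∃ m, n = m + 2 := ⟨n - 2, by omega⟩
  obtain ⟨k, rfl⟩ : ∃ l, k = l + 1 := ⟨k - 1, by omega⟩
  obtain ⟨p, rfl⟩ : ∃ p, i = p + 2 := ⟨i - 2, by omega⟩
  rw [betti_vanIdeal_eq (m := m + 1) (Nat.succ_ne_zero k) hβ (p + 1) j,
    betti_vanIdeal_eq (m := m) (k := k) (by omega) hβ' (p + 1) (j - (k + 1)),
    betti_vanIdeal_eq (m := m) (Nat.succ_ne_zero k) hβ'' (p + 1) j,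
    show p + 2 - 1 = p + 1 from rfl,
    betti_vanIdeal_eq (m := m) (Nat.succ_ne_zero k) hβ'' p (j - (k + 1))]
  exact card_cellFiber_succ m k p j
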